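/- Let G be a finite group. If the set of codegrees of the irreducible complex characters of G has at most three elements, i.e. |cod(G)| ≤ 3, then G is an M-group (every irreducible complex character of G is monomial). -/

import Mathlib

open scoped Classical

noncomputable section

/-- `χ : G → ℂ` is an irreducible complex character of the group `G`, i.e. it is the
character of some simple (irreducible) finite-dimensional complex representation of `G`. -/
def IsIrrChar (G : Type) [Group G] (χ : G → ℂ) : Prop :=
  ∃ V : FDRep ℂ G, CategoryTheory.Simple V ∧ χ = V.character

/-- The character of `G` induced from the class function `θ` of the subgroup `H`. -/
def indChar {G : Type} [Group G] (H : Subgroup G) (θ : ↥H → ℂ) : G → ℂ :=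
  fun g => (Nat.card H : ℂ)⁻¹ *
    ∑ᶠ x : G, if h : x⁻¹ * g * x ∈ H then θ ⟨x⁻¹ * g * x, h⟩ else 0

/-- `χ` is monomial: it is induced from a linear (degree-one) character of some subgroup,
a linear character of `H` being just a multiplicative homomorphism `H →* ℂ`. -/
def IsMonomialChar {G : Type} [Group G] (χ : G → ℂ) : Prop :=
  ∃ (H : Subgroup G) (lam : ↥H →* ℂ), χ = indChar H ⇑lam

/-- `G` is an `M`-group: every irreducible complex character of `G` is monomial. -/
def IsMGroup (G : Type) [Group G] : Prop :=
  ∀ χ : G → ℂ, IsIrrChar G χ → IsMonomialChar χ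

/-- The kernel of a character `χ` of `G`, as a set: `{g | χ g = χ 1}`. -/
def charKer {G : Type} [Group G] (χ : G → ℂ) : Set G :=
  {g : G | χ g = χ 1}

/-- The codegree of a character: `cod χ = |G : ker χ| / χ(1)`. -/
def codeg {G : Type} [Group G] (χ : G → ℂ) : ℂ :=
  ((Nat.card G : ℂ) / (Nat.card (charKer χ) : ℂ)) / χ 1

/-- The set of codegrees of the irreducible complex characters of `G`. -/
def codSet (G : Type) [Group G] : Set ℂ :=
  {c : ℂ | ∃ χ : G → ℂ, IsIrrChar G χ ∧ codeg χ = c}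

end


section FiniteOrder
variable {V : Type} [AddCommGroup V] [Module ℂ V] [FiniteDimensional ℂ V]

lemma finOrd_semisimple (T : Module.End ℂ V) (n : ℕ) (hn : 0 < n) (hT : T ^ n = 1) :
    T.IsSemisimple := by
  have hsq : Squarefree (Polynomial.X ^ n - 1 : Polynomial ℂ) := by
    apply Polynomial.Separable.squarefree
    have := Polynomial.separable_X_pow_sub_C (F := ℂ) (n := n) (1 : ℂ)
      (by exact_mod_cast hn.ne') one_ne_zero
    simpa using this
  refine Module.End.isSemisimple_of_squarefree_aeval_eq_zero hsq ?_
  simp [hT]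

/-- trace data of a finite order operator -/
lemma finOrd_trace (T S : Module.End ℂ V) (n : ℕ) (hn : 0 < n) (hT : T ^ n = 1) (hST : S * T = 1) :
    ∃ (s : Finset ℂ), (∀ μ ∈ s, ‖μ‖ = 1) ∧
      LinearMap.trace ℂ V T = ∑ μ ∈ s, μ * (Module.finrank ℂ (T.eigenspace μ) : ℂ) ∧
      LinearMap.trace ℂ V S = ∑ μ ∈ s, μ⁻¹ * (Module.finrank ℂ (T.eigenspace μ) : ℂ) ∧
      (Module.finrank ℂ V : ℂ) = ∑ μ ∈ s, (Module.finrank ℂ (T.eigenspace μ) : ℂ) ∧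
      (∀ μ, μ ∉ s → T.eigenspace μ = ⊥) ∧ (⨆ μ, T.eigenspace μ) = ⊤ := by
  have hss := finOrd_semisimple T n hn hT
  have htop := hss.iSup_eigenspace_eq_top
  have hind := T.eigenspaces_iSupIndep
  have hIntl : DirectSum.IsInternal (fun μ => T.eigenspace μ) :=
    (DirectSum.isInternal_submodule_iff_iSupIndep_and_iSup_eq_top _).2 ⟨hind, htop⟩
  have hfin : {μ | T.eigenspace μ ≠ ⊥}.Finite := WellFoundedGT.finite_ne_bot_of_iSupIndep hind
  have key : ∀ (R : Module.End ℂ V) (c : ℂ → ℂ),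
      (∀ μ, ∀ v ∈ T.eigenspace μ, R v = c μ • v) →
      LinearMap.trace ℂ V R = ∑ μ ∈ hfin.toFinset,
        c μ * (Module.finrank ℂ (T.eigenspace μ) : ℂ) := by
    intro R c hR
    have hm : ∀ μ, Set.MapsTo R (T.eigenspace μ) (T.eigenspace μ) := by
      intro μ v hv
      have := hR μ v hv
      rw [this]
      exact Submodule.smul_mem _ _ hv
    rw [LinearMap.trace_eq_sum_trace_restrict' hIntl hfin hm]
    refine Finset.sum_congr rfl fun μ _ => ?_
    have : R.restrict (hm μ) = c μ • LinearMap.id := by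
      refine LinearMap.ext fun v => Subtype.ext ?_
      exact hR μ v.1 v.2
    rw [this]
    simp
  refine ⟨hfin.toFinset, ?_, ?_, ?_, ?_, ?_, htop⟩
  · intro μ hμ
    have h1 : T.eigenspace μ ≠ ⊥ := by simpa using hμ
    obtain ⟨v, hv, hv0⟩ := Submodule.exists_mem_ne_zero_of_ne_bot h1
    have h2 : ∀ k : ℕ, (T ^ k) v = μ ^ k • v := by
      intro k
      induction k with
      | zero => simp
      | succ k ih =>
        rw [pow_succ, Module.End.mul_apply, Module.End.mem_eigenspace_iff.1 hv, map_smul, ih,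
          smul_smul, pow_succ, mul_comm]
    have h3 := h2 n
    rw [hT, Module.End.one_apply] at h3
    have h4 : μ ^ n = 1 := by
      have : (μ ^ n - 1) • v = 0 := by rw [sub_smul, ← h3, one_smul, sub_self]
      rcases smul_eq_zero.1 this with h | h
      · exact sub_eq_zero.1 h
      · exact absurd h hv0
    exact Complex.norm_eq_one_of_pow_eq_one h4 hn.ne'
  · exact key T (fun μ => μ) fun μ v hv => Module.End.mem_eigenspace_iff.1 hv
  · refine key S (fun μ => μ⁻¹) fun μ v hv => ?_
    have h1 : S (T v) = v := by rw [← Module.End.mul_apply, hST]; rfl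
    rw [Module.End.mem_eigenspace_iff.1 hv, map_smul] at h1
    by_cases h0 : μ = 0
    · subst h0; simp at h1; subst h1; simp
    · exact (eq_inv_smul_iff₀ h0).2 h1
  · have := key 1 (fun _ => 1) fun μ v _ => by simp
    simpa using this
  · intro μ hμ
    simpa using hμ

end FiniteOrder


section RepBasics
variable {G : Type} [Group G]

/-- Being the character of some finite-dimensional complex representation. -/
def IsChar (G : Type) [Group G] (f : G → ℂ) : Prop :=
  ∃ (V : Type) (_ : AddCommGroup V) (_ : Module ℂ V) (_ : FiniteDimensional ℂ V)
    (ρ : Representation ℂ G V), f = ρ.character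

/-- invariance of a subspace -/
def InvSub {V : Type} [AddCommGroup V] [Module ℂ V] (ρ : Representation ℂ G V)
    (W : Submodule ℂ V) : Prop := ∀ g : G, ∀ w ∈ W, ρ g w ∈ W

/-- elementary irreducibility -/
def IrrRep {V : Type} [AddCommGroup V] [Module ℂ V] (ρ : Representation ℂ G V) : Prop :=
  Nontrivial V ∧ ∀ W : Submodule ℂ V, InvSub ρ W → W = ⊥ ∨ W = ⊤

/-- restriction of a representation to an invariant subspace -/
def subRep {V : Type} [AddCommGroup V] [Module ℂ V] (ρ : Representation ℂ G V)
    (W : Submodule ℂ V) (hW : InvSub ρ W) : Representation ℂ G W where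
  toFun g := (ρ g).restrict (hW g)
  map_one' := by ext; simp
  map_mul' g h := by ext; simp

@[simp] lemma subRep_coe {V : Type} [AddCommGroup V] [Module ℂ V] (ρ : Representation ℂ G V)
    (W : Submodule ℂ V) (hW : InvSub ρ W) (g : G) (w : W) :
    ((subRep ρ W hW g w : W) : V) = ρ g w := rfl

variable {V : Type} [AddCommGroup V] [Module ℂ V]

lemma irrRep_iff (ρ : Representation ℂ G V) : IrrRep ρ ↔ ρ.IsIrreducible := by
  constructor
  · rintro ⟨hn, h⟩
    refine { exists_pair_ne := ?_, eq_bot_or_eq_top := ?_ }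
    · refine ⟨⊥, ⊤, fun hh => ?_⟩
      obtain ⟨v, hv⟩ := exists_ne (0 : V)
      have : v ∈ (⊤ : Subrepresentation ρ) := trivial
      rw [← hh] at this
      exact hv this
    · intro W
      rcases h W.toSubmodule (fun g w hw => W.apply_mem_toSubmodule g hw) with h | h
      · left; exact Subrepresentation.toSubmodule_injective h
      · right; exact Subrepresentation.toSubmodule_injective h
  · intro h
    have h1 : Nontrivial (Subrepresentation ρ) := h.toNontrivial
    constructor
    · by_contra hc
      rw [not_nontrivial_iff_subsingleton] at hc
      obtain ⟨A, B, hAB⟩ := exists_pair_ne (Subrepresentation ρ)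
      exact hAB (Subrepresentation.toSubmodule_injective (Subsingleton.elim _ _))
    · intro W hW
      have h2 := h.eq_bot_or_eq_top ⟨W, fun g v hv => hW g v hv⟩
      rcases h2 with h2 | h2
      · left; exact congrArg Subrepresentation.toSubmodule h2
      · right; exact congrArg Subrepresentation.toSubmodule h2

lemma exists_compl [Finite G] (ρ : Representation ℂ G V) (W : Submodule ℂ V) (hW : InvSub ρ W) :
    ∃ W', InvSub ρ W' ∧ IsCompl W W' := by
  have : NeZero (Nat.card G : ℂ) := ⟨by exact_mod_cast Nat.card_pos.ne'⟩
  have h : ρ.IsSemisimpleRepresentation := inferInstance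
  obtain ⟨Q, hQ⟩ := h.exists_isCompl ⟨W, fun g v hv => hW g v hv⟩
  refine ⟨Q.toSubmodule, fun g v hv => Q.apply_mem_toSubmodule g hv, ?_⟩
  constructor
  · rw [disjoint_iff]
    have := congrArg Subrepresentation.toSubmodule (disjoint_iff.1 hQ.1)
    exact this
  · rw [codisjoint_iff]
    have := congrArg Subrepresentation.toSubmodule (codisjoint_iff.1 hQ.2)
    exact this

lemma invSub_iSup {ι : Sort*} (ρ : Representation ℂ G V) (W : ι → Submodule ℂ V)
    (h : ∀ i, InvSub ρ (W i)) : InvSub ρ (⨆ i, W i) := by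
  intro g w hw
  have : (⨆ i, W i) ≤ (⨆ i, W i).comap (ρ g) := by
    apply iSup_le
    intro i v hv
    exact Submodule.mem_iSup_of_mem i (h i g v hv)
  exact this hw

variable [FiniteDimensional ℂ V]

lemma char_isChar (ρ : Representation ℂ G V) : IsChar G ρ.character :=
  ⟨V, _, _, inferInstance, ρ, rfl⟩

lemma isIrr_iff [Fintype G] {χ : G → ℂ} :
    IsIrrChar G χ ↔ IsChar G χ ∧ ∑ g, χ g * χ g⁻¹ = Nat.card G := by
  constructor
  · rintro ⟨V, hV, rfl⟩
    exact ⟨⟨V, inferInstance, inferInstance, inferInstance, V.ρ, rfl⟩,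
      (FDRep.simple_iff_char_is_norm_one V).1 hV⟩
  · rintro ⟨⟨V, _, _, _, ρ, rfl⟩, h⟩
    refine ⟨FDRep.of ρ, (FDRep.simple_iff_char_is_norm_one _).2 h, rfl⟩

lemma irr_of_irrRep [Finite G] (ρ : Representation ℂ G V) (h : IrrRep ρ) :
    IsIrrChar G ρ.character := by
  cases nonempty_fintype G
  rw [isIrr_iff]
  refine ⟨char_isChar ρ, ?_⟩
  have hc : (Nat.card G : ℂ) ≠ 0 := by exact_mod_cast Nat.card_pos.ne'
  have : Invertible (Nat.card G : ℂ) := invertibleOfNonzero hc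
  have h1 := Representation.card_inv_mul_sum_char_mul_char_eq_finrank ρ ρ
  have := (irrRep_iff ρ).1 h
  rw [Representation.IsIrreducible.finrank_intertwiningMap_self] at h1
  field_simp at h1
  simpa using h1

lemma irrRep_of_norm [Fintype G] (ρ : Representation ℂ G V)
    (h : ∑ g, ρ.character g * ρ.character g⁻¹ = Nat.card G) : IrrRep ρ := by
  have hc : (Nat.card G : ℂ) ≠ 0 := by exact_mod_cast Nat.card_pos.ne'
  have : Invertible (Nat.card G : ℂ) := invertibleOfNonzero hc
  have h1 := Representation.card_inv_mul_sum_char_mul_char_eq_finrank ρ ρ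
  rw [h, inv_mul_cancel₀ hc] at h1
  have h2 : Module.finrank ℂ (Representation.IntertwiningMap ρ ρ) = 1 := by
    exact_mod_cast h1.symm
  have hV : Nontrivial V := by
    by_contra hV
    rw [not_nontrivial_iff_subsingleton] at hV
    have : Subsingleton (Representation.IntertwiningMap ρ ρ) :=
      ⟨fun a b => by ext v; exact Subsingleton.elim _ _⟩
    rw [Module.finrank_zero_of_subsingleton] at h2
    exact absurd h2 (by norm_num)
  refine ⟨hV, fun W hW => ?_⟩
  obtain ⟨W', hW', hc'⟩ := exists_compl ρ W hW
  let P : Module.End ℂ V := W.subtype ∘ₗ W.projectionOnto W' hc'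
  have hP1 : ∀ w ∈ W, P w = w := fun w hw => by
    have := Submodule.projectionOnto_apply_left hc' ⟨w, hw⟩
    simp only [P, LinearMap.comp_apply]
    rw [this]; rfl
  have hP2 : ∀ w ∈ W', P w = 0 := fun w hw => by
    have := (Submodule.projectionOnto_apply_eq_zero_iff hc').2 hw
    simp only [P, LinearMap.comp_apply]
    rw [this]; rfl
  have hP : ∀ g v, P (ρ g v) = ρ g (P v) := by
    intro g v
    have hv : v ∈ W ⊔ W' := by rw [hc'.sup_eq_top]; trivial
    obtain ⟨a, ha, b, hb, rfl⟩ := Submodule.mem_sup.1 hv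
    simp only [map_add, hP1 a ha, hP2 b hb, hP1 _ (hW g a ha), hP2 _ (hW' g b hb), map_zero]
  let PP : Representation.IntertwiningMap ρ ρ := ⟨P, fun g => by ext v; exact hP g v⟩
  let II : Representation.IntertwiningMap ρ ρ := ⟨LinearMap.id, fun g => by ext v; rfl⟩
  have hII : II ≠ 0 := by
    obtain ⟨v, hv⟩ := exists_ne (0 : V)
    intro h0
    exact hv (congrArg (fun f : Representation.IntertwiningMap ρ ρ => f v) h0)
  obtain ⟨c, hcc⟩ := (finrank_eq_one_iff_of_nonzero' II hII).1 h2 PP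
  have hc2 : ∀ v, c • v = P v := fun v =>
    congrArg (fun f : Representation.IntertwiningMap ρ ρ => f v) hcc
  by_cases h0 : c = 0
  · left
    rw [eq_bot_iff]
    intro w hw
    have := hP1 w hw
    rw [← hc2, h0, zero_smul] at this
    simp [← this]
  · right
    rw [eq_top_iff]
    intro v _
    have h3 : P v ∈ W := by simp [P]
    rw [← hc2] at h3
    exact (Submodule.smul_mem_iff _ h0).1 h3

lemma IsIrrChar.exists_rep [Finite G] {χ : G → ℂ} (h : IsIrrChar G χ) :
    ∃ (V : Type) (_ : AddCommGroup V) (_ : Module ℂ V) (_ : FiniteDimensional ℂ V)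
    (ρ : Representation ℂ G V), IrrRep ρ ∧ χ = ρ.character := by
  cases nonempty_fintype G
  obtain ⟨⟨V, i1, i2, i3, ρ, rfl⟩, h2⟩ := isIrr_iff.1 h
  exact ⟨V, i1, i2, i3, ρ, irrRep_of_norm ρ h2, rfl⟩

lemma IsIrrChar.isChar [Finite G] {χ : G → ℂ} (h : IsIrrChar G χ) : IsChar G χ := by
  cases nonempty_fintype G
  exact (isIrr_iff.1 h).1

end RepBasics


section CharOps
variable {G : Type} [Group G]

lemma IsChar.mul {f g : G → ℂ} (hf : IsChar G f) (hg : IsChar G g) : IsChar G (f * g) := by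
  obtain ⟨V, _, _, _, ρ, rfl⟩ := hf
  obtain ⟨W, _, _, _, σ, rfl⟩ := hg
  exact ⟨TensorProduct ℂ V W, _, _, inferInstance, ρ.tprod σ,
    (Representation.char_tensor ρ σ).symm⟩

lemma IsChar.inv {f : G → ℂ} (hf : IsChar G f) : IsChar G (fun x => f x⁻¹) := by
  obtain ⟨V, _, _, _, ρ, rfl⟩ := hf
  exact ⟨Module.Dual ℂ V, _, _, inferInstance, ρ.dual,
    funext fun g => (Representation.char_dual ρ g).symm⟩

lemma IsChar.comp {H : Type} [Group H] {f : G → ℂ} (hf : IsChar G f) (φ : H →* G) :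
    IsChar H (fun x => f (φ x)) := by
  obtain ⟨V, _, _, _, ρ, rfl⟩ := hf
  exact ⟨V, _, _, inferInstance, ρ.comp φ, rfl⟩

lemma isChar_lin (l : G →* ℂˣ) : IsChar G (fun x => (l x : ℂ)) := by
  let ρ : Representation ℂ G ℂ :=
    { toFun := fun g => (l g : ℂ) • LinearMap.id
      map_one' := by ext; simp
      map_mul' := fun g h => by ext; simp [mul_comm] }
  refine ⟨ℂ, _, _, inferInstance, ρ, funext fun g => ?_⟩
  simp [Representation.character, ρ]

lemma IsChar.conj {f : G → ℂ} (hf : IsChar G f) (g h : G) : f (h * g * h⁻¹) = f g := by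
  obtain ⟨V, _, _, _, ρ, rfl⟩ := hf
  exact ρ.char_conj g h

/-- The degree as a natural number. -/
noncomputable def dg (f : G → ℂ) : ℕ := ⌊‖f 1‖⌋₊

lemma IsChar.one_eq {f : G → ℂ} (hf : IsChar G f) : f 1 = dg f := by
  obtain ⟨V, _, _, _, ρ, rfl⟩ := hf
  simp [dg, Representation.char_one]

lemma dg_char {V : Type} [AddCommGroup V] [Module ℂ V] [FiniteDimensional ℂ V]
    (ρ : Representation ℂ G V) : dg ρ.character = Module.finrank ℂ V := by
  simp [dg, Representation.char_one]

lemma rep_pow_card [Finite G] {V : Type} [AddCommGroup V] [Module ℂ V]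
    (ρ : Representation ℂ G V) (g : G) : (ρ g) ^ (Nat.card G) = 1 := by
  rw [← map_pow, pow_card_eq_one', map_one]

lemma rep_inv_mul {V : Type} [AddCommGroup V] [Module ℂ V]
    (ρ : Representation ℂ G V) (g : G) : (ρ g⁻¹) * ρ g = 1 := by
  rw [← map_mul, inv_mul_cancel, map_one]

lemma IsChar.inv_eq [Finite G] {f : G → ℂ} (hf : IsChar G f) (g : G) :
    f g⁻¹ = (starRingEnd ℂ) (f g) := by
  obtain ⟨V, _, _, _, ρ, rfl⟩ := hf
  obtain ⟨s, h1, h2, h3, -⟩ := finOrd_trace (ρ g) (ρ g⁻¹) (Nat.card G) Nat.card_pos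
    (rep_pow_card ρ g) (rep_inv_mul ρ g)
  rw [Representation.character, Representation.character, h2, h3, map_sum]
  refine Finset.sum_congr rfl fun μ hμ => ?_
  rw [map_mul, Complex.inv_eq_conj (h1 μ hμ)]
  simp

lemma IsChar.mul_inv_eq [Finite G] {f : G → ℂ} (hf : IsChar G f) (g : G) :
    f g * f g⁻¹ = ((‖f g‖ ^ 2 : ℝ) : ℂ) := by
  rw [hf.inv_eq, Complex.mul_conj, Complex.normSq_eq_norm_sq]

lemma charKer_eq [Finite G] {V : Type} [AddCommGroup V] [Module ℂ V] [FiniteDimensional ℂ V]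
    (ρ : Representation ℂ G V) (g : G) : ρ.character g = ρ.character 1 ↔ ρ g = 1 := by
  constructor
  · intro h
    obtain ⟨s, h1, h2, h3, h4, h5, h6⟩ := finOrd_trace (ρ g) (ρ g⁻¹) (Nat.card G) Nat.card_pos
      (rep_pow_card ρ g) (rep_inv_mul ρ g)
    rw [Representation.char_one, Representation.character, h2, h4] at h
    have h7 := congrArg Complex.re h
    rw [Complex.re_sum, Complex.re_sum] at h7
    simp only [Complex.mul_re, Complex.natCast_re, Complex.natCast_im, mul_zero, sub_zero] at h7
    have h8 : ∀ μ ∈ s, μ.re * (Module.finrank ℂ (Module.End.eigenspace (ρ g) μ) : ℝ) ≤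
        (Module.finrank ℂ (Module.End.eigenspace (ρ g) μ) : ℝ) := by
      intro μ hμ
      have : μ.re ≤ 1 := (Complex.re_le_norm μ).trans (h1 μ hμ).le
      exact mul_le_of_le_one_left (Nat.cast_nonneg _) this
    have h9 := (Finset.sum_eq_sum_iff_of_le h8).1 h7
    have h10 : ∀ μ, μ ≠ 1 → Module.End.eigenspace (ρ g) μ = ⊥ := by
      intro μ hμ1
      by_cases hμ : μ ∈ s
      · have h11 := h9 μ hμ
        by_contra hne
        have h12 : (Module.finrank ℂ (Module.End.eigenspace (ρ g) μ) : ℝ) ≠ 0 := by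
          intro h0
          exact hne (Submodule.finrank_eq_zero.1 (by exact_mod_cast h0))
        have h13 : μ.re = 1 := by
          rw [← sub_eq_zero, ← sub_one_mul] at h11
          rcases mul_eq_zero.1 h11 with h | h
          · linarith
          · exact absurd h h12
        apply hμ1
        have h14 := h1 μ hμ
        have h15 := Complex.sq_norm μ
        rw [h14, Complex.normSq_apply, h13] at h15
        have : μ.im = 0 := by nlinarith
        exact Complex.ext (by simpa using h13) (by simpa using this)
      · exact h5 μ hμ
    have h11 : Module.End.eigenspace (ρ g) 1 = ⊤ := by
      rw [eq_top_iff, ← h6]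
      apply iSup_le
      intro μ
      by_cases h : μ = 1
      · rw [h]
      · rw [h10 μ h]; exact bot_le
    ext v
    have : v ∈ Module.End.eigenspace (ρ g) 1 := by rw [h11]; trivial
    simpa using Module.End.mem_eigenspace_iff.1 this
  · intro h
    simp [Representation.character, h]

/-- The kernel of a character as a subgroup. -/
lemma IsChar.exists_ker [Finite G] {f : G → ℂ} (hf : IsChar G f) :
    ∃ K : Subgroup G, K.Normal ∧ (K : Set G) = charKer f := by
  obtain ⟨V, _, _, _, ρ, rfl⟩ := hf
  refine ⟨MonoidHom.ker ρ, inferInstance, ?_⟩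
  ext g
  simp only [charKer, Set.mem_setOf_eq, SetLike.mem_coe, MonoidHom.mem_ker]
  exact (charKer_eq ρ g).symm

lemma IsChar.norm_le [Finite G] {f : G → ℂ} (hf : IsChar G f) (g : G) : ‖f g‖ ≤ dg f := by
  obtain ⟨V, _, _, _, ρ, rfl⟩ := hf
  obtain ⟨s, h1, h2, h3, h4, h5, h6⟩ := finOrd_trace (ρ g) (ρ g⁻¹) (Nat.card G) Nat.card_pos
      (rep_pow_card ρ g) (rep_inv_mul ρ g)
  rw [dg_char, Representation.character, h2]
  refine (norm_sum_le _ _).trans ?_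
  have h7 : (Module.finrank ℂ V : ℝ) = ∑ μ ∈ s, (Module.finrank ℂ (Module.End.eigenspace (ρ g) μ) : ℝ) := by
    exact_mod_cast h4
  rw [h7]
  refine Finset.sum_le_sum fun μ hμ => ?_
  rw [norm_mul, h1 μ hμ]
  simp

end CharOps

section Orth
variable {G : Type} [Group G] [Fintype G]

/-- scalar product of class functions -/
noncomputable def ip (f g : G → ℂ) : ℂ := (Nat.card G : ℂ)⁻¹ * ∑ x, f x * g x⁻¹

lemma ip_add (f f' g : G → ℂ) : ip (f + f') g = ip f g + ip f' g := by
  simp [ip, add_mul, Finset.sum_add_distrib, mul_add]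

lemma ip_smul (c : ℂ) (f g : G → ℂ) : ip (c • f) g = c * ip f g := by
  simp [ip, mul_assoc, Finset.mul_sum, mul_left_comm]

lemma ip_sum {ι : Type*} (s : Finset ι) (f : ι → G → ℂ) (g : G → ℂ) :
    ip (∑ i ∈ s, f i) g = ∑ i ∈ s, ip (f i) g := by
  classical
  induction s using Finset.induction_on with
  | empty => simp [ip]
  | insert a s ha ih => rw [Finset.sum_insert ha, Finset.sum_insert ha, ip_add, ih]

lemma ip_mul_left (f g h : G → ℂ) : ip (f * g) h = ip g (fun x => f x⁻¹ * h x) := by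
  simp only [ip, Pi.mul_apply, inv_inv]
  congr 1
  exact Finset.sum_congr rfl fun x _ => by ring

lemma ip_comm (f g : G → ℂ) : ip f g = ip g f := by
  simp only [ip]
  congr 1
  rw [← Equiv.sum_comp (Equiv.inv G)]
  exact Finset.sum_congr rfl fun x _ => by simp [mul_comm]

lemma card_ne : (Nat.card G : ℂ) ≠ 0 := by exact_mod_cast Nat.card_pos.ne'

lemma irr_iff_ip {χ : G → ℂ} : IsIrrChar G χ ↔ IsChar G χ ∧ ip χ χ = 1 := by
  rw [isIrr_iff, ip, inv_mul_eq_one₀ card_ne]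
  constructor <;> rintro ⟨h1, h2⟩ <;> exact ⟨h1, h2.symm⟩

lemma ip_char {V W : Type} [AddCommGroup V] [Module ℂ V] [FiniteDimensional ℂ V]
    [AddCommGroup W] [Module ℂ W] [FiniteDimensional ℂ W] (σ : Representation ℂ G V)
    (ρ : Representation ℂ G W) : ip σ.character ρ.character =
      Module.finrank ℂ (Representation.IntertwiningMap ρ σ) := by
  have : Invertible (Nat.card G : ℂ) := invertibleOfNonzero card_ne
  rw [← Representation.card_inv_mul_sum_char_mul_char_eq_finrank]
  rfl

lemma ip_orth {χ ψ : G → ℂ} (hχ : IsIrrChar G χ) (hψ : IsIrrChar G ψ) :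
    ip χ ψ = if χ = ψ then 1 else 0 := by
  split_ifs with h
  · subst h; exact (irr_iff_ip.1 hχ).2
  · obtain ⟨V, _, _, _, σ, hσ, rfl⟩ := hχ.exists_rep
    obtain ⟨W, _, _, _, ρ, hρ, rfl⟩ := hψ.exists_rep
    have := (irrRep_iff _).1 hσ
    have := (irrRep_iff _).1 hρ
    have : IsEmpty (Representation.Equiv ρ σ) := by
      by_contra hne
      rw [not_isEmpty_iff] at hne
      obtain ⟨e⟩ := hne
      exact h (Representation.char_iso e).symm
    rw [ip_char, Module.finrank_zero_of_subsingleton]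
    simp

lemma irr_finite (G : Type) [Group G] [Finite G] : {χ : G → ℂ | IsIrrChar G χ}.Finite := by
  cases nonempty_fintype G
  have : LinearIndependent ℂ (fun χ : {χ : G → ℂ | IsIrrChar G χ} => (χ : G → ℂ)) := by
    rw [linearIndependent_iff']
    intro s g hg i hi
    have h1 := congrArg (fun f => ip f (i : G → ℂ)) hg
    simp only [ip_sum, ip_smul] at h1
    have h2 : ∀ x ∈ s, g x * ip (x : G → ℂ) (i : G → ℂ) = if x = i then g i else 0 := by
      intro x _
      rw [ip_orth x.2 i.2]
      by_cases hx : x = i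
      · simp [hx]
      · have : (x : G → ℂ) ≠ i := fun h => hx (Subtype.ext h)
        simp [hx, this]
    rw [Finset.sum_congr rfl h2] at h1
    simpa [ip, hi] using h1
  exact this.setFinite

/-- finset of irreducible characters -/
noncomputable def irrF (G : Type) [Group G] [Finite G] : Finset (G → ℂ) := (irr_finite G).toFinset

lemma mem_irrF {χ : G → ℂ} : χ ∈ irrF G ↔ IsIrrChar G χ := by simp [irrF]

/-- decomposition into irreducibles, with multiplicities -/
lemma decomp_aux (n : ℕ) : ∀ (V : Type) [AddCommGroup V] [Module ℂ V] [FiniteDimensional ℂ V]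
    (ρ : Representation ℂ G V), Module.finrank ℂ V = n → 
    ∃ m : (G → ℂ) → ℕ, ρ.character = ∑ χ ∈ irrF G, (m χ : ℂ) • χ := by
  induction n using Nat.strong_induction_on with
  | _ n ih =>
    intro V _ _ _ ρ hn
    by_cases hI : IrrRep ρ
    · refine ⟨fun χ => if χ = ρ.character then 1 else 0, ?_⟩
      have : ρ.character ∈ irrF G := mem_irrF.2 (irr_of_irrRep ρ hI)
      rw [Finset.sum_eq_single_of_mem _ this]
      · simp
      · intro b _ hb; simp [hb]
    · by_cases hV : Nontrivial V
      · have h1 : ∃ W : Submodule ℂ V, InvSub ρ W ∧ W ≠ ⊥ ∧ W ≠ ⊤ := by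
          by_contra hcon
          push Not at hcon
          refine hI ⟨hV, fun W hW => ?_⟩
          by_cases hb : W = ⊥
          · exact Or.inl hb
          · exact Or.inr (hcon W hW hb)
        obtain ⟨W, hW, hb, ht⟩ := h1
        obtain ⟨W', hW', hc⟩ := exists_compl ρ W hW
        have hadd := Submodule.finrank_add_eq_of_isCompl hc
        have hW1 : 0 < Module.finrank ℂ W := by
          rw [Nat.pos_iff_ne_zero]
          exact fun h => hb (Submodule.finrank_eq_zero.1 h)
        have hW1' : 0 < Module.finrank ℂ W' := by
          rw [Nat.pos_iff_ne_zero]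
          intro h
          have := Submodule.finrank_eq_zero.1 h
          subst this
          exact ht (by simpa using hc.sup_eq_top)
        obtain ⟨m1, h1⟩ := ih (Module.finrank ℂ W) (by omega) W (subRep ρ W hW) rfl
        obtain ⟨m2, h2⟩ := ih (Module.finrank ℂ W') (by omega) W' (subRep ρ W' hW') rfl
        refine ⟨fun χ => m1 χ + m2 χ, ?_⟩
        have h3 : ρ.character = (subRep ρ W hW).character + (subRep ρ W' hW').character := by
          funext g
          let N : Bool → Submodule ℂ V := fun b => if b then W else W'
          have hIntl : DirectSum.IsInternal N := by
            rw [DirectSum.isInternal_submodule_iff_isCompl N (i := true) (j := false) (by simp)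
              (by ext b; cases b <;> simp)]
            simpa [N] using hc
          have hm : ∀ b, Set.MapsTo (ρ g) (N b) (N b) := by
            intro b
            cases b
            · exact hW' g
            · exact hW g
          have := LinearMap.trace_eq_sum_trace_restrict hIntl hm
          rw [Fintype.sum_bool] at this
          exact this
        rw [h3, h1, h2, ← Finset.sum_add_distrib]
        refine Finset.sum_congr rfl fun χ _ => ?_
        push_cast
        rw [add_smul]
      · refine ⟨fun _ => 0, ?_⟩
        rw [not_nontrivial_iff_subsingleton] at hV
        funext g
        have : ρ g = 0 := by ext v; exact Subsingleton.elim _ _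
        simp [Representation.character, this]

lemma IsChar.decomp {f : G → ℂ} (hf : IsChar G f) :
    ∃ m : (G → ℂ) → ℕ, f = ∑ χ ∈ irrF G, (m χ : ℂ) • χ ∧
      ∀ χ, IsIrrChar G χ → (m χ : ℂ) = ip f χ := by
  obtain ⟨V, _, _, _, ρ, rfl⟩ := hf
  obtain ⟨m, hm⟩ := decomp_aux _ V ρ rfl
  refine ⟨m, hm, fun χ hχ => ?_⟩
  rw [hm, ip_sum, Finset.sum_eq_single_of_mem χ (mem_irrF.2 hχ)]
  · rw [ip_smul, ip_orth hχ hχ]; simp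
  · intro b hb hne
    rw [ip_smul, ip_orth (mem_irrF.1 hb) hχ]; simp [hne]

end Orth


section Regular
variable {G : Type} [Group G] 

/-- the regular representation on functions -/
noncomputable def regR (G : Type) [Group G] : Representation ℂ G (G → ℂ) where
  toFun g := LinearMap.funLeft ℂ ℂ (fun x => g⁻¹ * x)
  map_one' := by ext; simp [LinearMap.funLeft]
  map_mul' g h := by ext f x; simp [LinearMap.funLeft, mul_assoc]

lemma regR_char [Fintype G] (g : G) :
    (regR G).character g = if g = 1 then (Nat.card G : ℂ) else 0 := by
  rw [Representation.character, LinearMap.trace_eq_matrix_trace ℂ (Pi.basisFun ℂ G), Matrix.trace]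
  have : ∀ x : G, ((LinearMap.toMatrix (Pi.basisFun ℂ G) (Pi.basisFun ℂ G)) (regR G g)).diag x
      = if g = 1 then 1 else 0 := by
    intro x
    rw [Matrix.diag_apply, LinearMap.toMatrix_apply]
    simp [regR, LinearMap.funLeft, Pi.single_apply]
  rw [Finset.sum_congr rfl fun x _ => this x]
  split_ifs <;> simp

lemma reg_sum [Fintype G] (g : G) :
    ∑ χ ∈ irrF G, (dg χ : ℂ) * χ g = if g = 1 then (Nat.card G : ℂ) else 0 := by
  obtain ⟨m, h1, h2⟩ := (char_isChar (regR G)).decomp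
  rw [← regR_char, h1, Finset.sum_apply]
  refine Finset.sum_congr rfl fun χ hχ => ?_
  have hi := mem_irrF.1 hχ
  rw [Pi.smul_apply, smul_eq_mul, h2 χ hi, ip]
  congr 1
  have : ∀ x : G, (regR G).character x * χ x⁻¹ = if x = 1 then (Nat.card G : ℂ) * χ 1 else 0 := by
    intro x
    rw [regR_char]
    split_ifs with h
    · simp [h]
    · simp
  rw [Finset.sum_congr rfl fun x _ => this x]
  simp only [Finset.sum_ite_eq', Finset.mem_univ, if_true]
  rw [inv_mul_cancel_left₀ card_ne, hi.isChar.one_eq]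

lemma sum_sq_all [Finite G] : ∑ χ ∈ irrF G, (dg χ) ^ 2 = Nat.card G := by
  cases nonempty_fintype G
  have h := reg_sum (1 : G)
  rw [if_pos rfl] at h
  have : ∑ χ ∈ irrF G, (dg χ : ℂ) * χ 1 = ∑ χ ∈ irrF G, ((dg χ : ℂ)) ^ 2 :=
    Finset.sum_congr rfl fun χ hχ => by rw [(mem_irrF.1 hχ).isChar.one_eq, sq]
  rw [this] at h
  exact_mod_cast h

lemma IsIrrChar.sumN [Finite G] {χ : G → ℂ} (hχ : IsIrrChar G χ) (N : Subgroup G) [hN : N.Normal]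
    [Fintype N] :
    ∑ n : N, χ n = if (N : Set G) ⊆ charKer χ then (Nat.card N : ℂ) * dg χ else 0 := by
  split_ifs with h
  · have : ∀ n : N, χ n = dg χ := fun n => by
      rw [← hχ.isChar.one_eq]; exact h n.2
    rw [Finset.sum_congr rfl fun n _ => this n]
    simp
  · obtain ⟨V, _, _, _, ρ, hρ, rfl⟩ := hχ.exists_rep
    let W : Submodule ℂ V :=
      { carrier := {v | ∀ n ∈ N, ρ n v = v}
        add_mem' := fun {a b} ha hb n hn => by rw [map_add, ha n hn, hb n hn]
        zero_mem' := fun n _ => map_zero _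
        smul_mem' := fun c v hv n hn => by rw [map_smul, hv n hn] }
    have hW : InvSub ρ W := by
      intro g w hw n hn
      have h1 : n * g = g * (g⁻¹ * n * g) := by group
      have h2 : g⁻¹ * n * g ∈ N := by simpa using hN.conj_mem n hn g⁻¹
      rw [← Module.End.mul_apply, ← map_mul, h1, map_mul, Module.End.mul_apply, hw _ h2]
    rcases hρ.2 W hW with h1 | h1
    · have h2 : ∑ n : N, ρ n = 0 := by
        ext v
        have : (∑ n : N, ρ n) v ∈ W := by
          intro m hm
          rw [LinearMap.sum_apply, map_sum]
          rw [← Equiv.sum_comp (Equiv.mulLeft (⟨m, hm⟩ : N)) (fun n : N => ρ n v)]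
          simp [map_mul]
        rw [h1] at this
        simpa using this
      have h3 : ∑ n : N, ρ.character n = LinearMap.trace ℂ V (∑ n : N, ρ n) := by
        rw [map_sum]; rfl
      rw [h3, h2, map_zero]
    · exfalso
      apply h
      intro n hn
      refine (charKer_eq ρ n).2 ?_
      ext v
      have : v ∈ W := by rw [h1]; trivial
      exact this n hn

lemma sum_sq_ker [Finite G] (N : Subgroup G) [hN : N.Normal] :
    Nat.card N * ∑ χ ∈ irrF G with (N : Set G) ⊆ charKer χ, (dg χ) ^ 2 = Nat.card G := by
  cases nonempty_fintype G
  have h1 : ∑ n : N, ∑ χ ∈ irrF G, (dg χ : ℂ) * χ n = Nat.card G := by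
    have h0 : ∀ n : N, ∑ χ ∈ irrF G, (dg χ : ℂ) * χ n = if n = 1 then (Nat.card G : ℂ) else 0 := by
      intro n
      rw [reg_sum (n : G)]
      simp
    rw [Finset.sum_congr rfl fun n _ => h0 n]
    simp
  rw [Finset.sum_comm] at h1
  have h2 : ∀ χ ∈ irrF G, ∑ n : N, (dg χ : ℂ) * χ n =
      if (N : Set G) ⊆ charKer χ then (Nat.card N : ℂ) * (dg χ : ℂ) ^ 2 else 0 := by
    intro χ hχ
    rw [← Finset.mul_sum, (mem_irrF.1 hχ).sumN N]
    split_ifs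
    · ring
    · ring
  rw [Finset.sum_congr rfl h2, ← Finset.sum_filter, ← Finset.mul_sum] at h1
  exact_mod_cast h1

/-- sum of squares of degrees of characters not containing `N` in the kernel -/
lemma sum_sq_F [Finite G] (N : Subgroup G) [hN : N.Normal] :
    Nat.card N * ∑ χ ∈ irrF G with ¬ (N : Set G) ⊆ charKer χ, (dg χ) ^ 2
      = Nat.card G * (Nat.card N - 1) := by
  have h1 := sum_sq_ker N
  have h2 := sum_sq_all (G := G)
  rw [← Finset.sum_filter_add_sum_filter_not (irrF G) (fun χ => (N : Set G) ⊆ charKer χ)] at h2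
  set A := ∑ χ ∈ irrF G with (N : Set G) ⊆ charKer χ, (dg χ) ^ 2
  set B := ∑ χ ∈ irrF G with ¬ (N : Set G) ⊆ charKer χ, (dg χ) ^ 2
  have h3 : 0 < Nat.card N := Nat.card_pos
  obtain ⟨k, hk⟩ : ∃ k, Nat.card N = k + 1 := ⟨Nat.card N - 1, by omega⟩
  rw [hk] at h1 ⊢
  rw [Nat.add_sub_cancel, ← h2]
  rw [← h2] at h1
  nlinarith

lemma IsIrrChar.dg_pos [Finite G] {χ : G → ℂ} (hχ : IsIrrChar G χ) : 0 < dg χ := by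
  obtain ⟨V, _, _, _, ρ, hρ, rfl⟩ := hχ.exists_rep
  rw [dg_char]
  have := hρ.1
  exact Module.finrank_pos

lemma irr_lin [Finite G] (l : G →* ℂˣ) : IsIrrChar G (fun x => (l x : ℂ)) := by
  cases nonempty_fintype G
  refine isIrr_iff.2 ⟨isChar_lin l, ?_⟩
  simp

lemma irr_one [Finite G] : IsIrrChar G (1 : G → ℂ) := by
  have := irr_lin (1 : G →* ℂˣ)
  have h : (fun x : G => (((1 : G →* ℂˣ) x : ℂˣ) : ℂ)) = 1 := by funext x; simp
  rwa [h] at this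

lemma IsIrrChar.lin_mul [Finite G] {χ : G → ℂ} (hχ : IsIrrChar G χ) (l : G →* ℂˣ) :
    IsIrrChar G (fun x => (l x : ℂ) * χ x) := by
  cases nonempty_fintype G
  refine isIrr_iff.2 ⟨(isChar_lin l).mul hχ.isChar, ?_⟩
  rw [← (isIrr_iff.1 hχ).2]
  refine Finset.sum_congr rfl fun x _ => ?_
  have : (l x : ℂ) * (l x⁻¹ : ℂ) = 1 := by simp
  linear_combination (χ x * χ x⁻¹) * this

lemma IsIrrChar.inv [Finite G] {χ : G → ℂ} (hχ : IsIrrChar G χ) :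
    IsIrrChar G (fun x => χ x⁻¹) := by
  cases nonempty_fintype G
  refine isIrr_iff.2 ⟨hχ.isChar.inv, ?_⟩
  rw [← (isIrr_iff.1 hχ).2]
  refine Finset.sum_congr rfl fun x _ => ?_
  rw [inv_inv, mul_comm]

lemma lemmaB [Finite G] {χ : G → ℂ} (hχ : IsIrrChar G χ) (h1 : χ ≠ 1) :
    Nat.card (charKer χ) * dg χ ^ 2 < Nat.card G := by
  cases nonempty_fintype G
  have hN : ∑ g, ‖χ g‖ ^ 2 = (Nat.card G : ℝ) := by
    have := (isIrr_iff.1 hχ).2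
    rw [Finset.sum_congr rfl fun g _ => hχ.isChar.mul_inv_eq g] at this
    exact_mod_cast this
  have hker : ∑ g with g ∈ charKer χ, ‖χ g‖ ^ 2 = (Nat.card (charKer χ) * dg χ ^ 2 : ℝ) := by
    have : ∀ g ∈ Finset.univ.filter (fun g => g ∈ charKer χ), ‖χ g‖ ^ 2 = (dg χ : ℝ) ^ 2 := by
      intro g hg
      have : χ g = χ 1 := (Finset.mem_filter.1 hg).2
      rw [this, hχ.isChar.one_eq]; simp
    rw [Finset.sum_congr rfl this]
    simp [Fintype.card_subtype]
  rw [← Finset.sum_filter_add_sum_filter_not _ (fun g => g ∈ charKer χ), hker] at hN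
  have hnn : 0 ≤ ∑ g with g ∉ charKer χ, ‖χ g‖ ^ 2 := Finset.sum_nonneg fun _ _ => by positivity
  rcases hnn.lt_or_eq with hlt | heq
  · have : (Nat.card (charKer χ) * dg χ ^ 2 : ℝ) < Nat.card G := by linarith
    exact_mod_cast this
  · exfalso
    have h0 := (Finset.sum_eq_zero_iff_of_nonneg (fun _ _ => by positivity)).1 heq.symm
    have h2 := ip_orth hχ irr_one
    rw [if_neg h1, ip] at h2
    have h3 : ∑ x, χ x * (1 : G → ℂ) x⁻¹ = (Nat.card (charKer χ) : ℂ) * dg χ := by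
      have : ∀ x, χ x * (1 : G → ℂ) x⁻¹ = if x ∈ charKer χ then (dg χ : ℂ) else 0 := by
        intro x
        split_ifs with hx
        · rw [← hχ.isChar.one_eq, ← (show χ x = χ 1 from hx)]; simp
        · have := h0 x (by simpa using hx)
          have : χ x = 0 := by simpa using this
          simp [this]
      rw [Finset.sum_congr rfl fun x _ => this x, ← Finset.sum_filter]
      simp [Fintype.card_subtype]
    rw [h3] at h2
    have h4 : (Nat.card (charKer χ) : ℂ) ≠ 0 := by
      have : Nonempty (charKer χ) := ⟨⟨1, rfl⟩⟩
      exact_mod_cast Nat.card_pos.ne'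
    have h5 : (dg χ : ℂ) ≠ 0 := by exact_mod_cast hχ.dg_pos.ne'
    have h6 := card_ne (G := G)
    exact (mul_ne_zero (inv_ne_zero h6) (mul_ne_zero h4 h5)) h2

lemma IsIrrChar.codeg_mul [Finite G] {χ : G → ℂ} (hχ : IsIrrChar G χ) :
    codeg χ * (Nat.card (charKer χ) * dg χ : ℕ) = Nat.card G := by
  have h4 : (Nat.card (charKer χ) : ℂ) ≠ 0 := by
    have : Nonempty (charKer χ) := ⟨⟨1, rfl⟩⟩
    exact_mod_cast Nat.card_pos.ne'
  have h5 : (dg χ : ℂ) ≠ 0 := by exact_mod_cast hχ.dg_pos.ne'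
  rw [codeg, hχ.isChar.one_eq]
  push_cast
  field_simp

lemma card_comp_surj {Q : Type} [Group Q] [Finite G] (φ : G →* Q) (hφ : Function.Surjective φ)
    (S : Set Q) : Nat.card (φ ⁻¹' S) = Nat.card φ.ker * Nat.card S := by
  rw [← Nat.card_prod]
  refine Nat.card_congr ?_
  refine Equiv.symm (Equiv.ofBijective (fun x => ⟨Function.surjInv hφ x.2.1 * x.1.1, ?_⟩) ⟨?_, ?_⟩)
  · have : φ x.1.1 = 1 := x.1.2
    rw [Set.mem_preimage, map_mul, this, mul_one, Function.surjInv_eq hφ]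
    exact x.2.2
  · rintro ⟨⟨a, ha⟩, ⟨s, hs⟩⟩ ⟨⟨b, hb⟩, ⟨t, ht⟩⟩ h
    have h' := congrArg Subtype.val h
    simp only at h'
    have h'' := congrArg φ h'
    rw [map_mul, map_mul, MonoidHom.mem_ker.1 ha, MonoidHom.mem_ker.1 hb, mul_one, mul_one,
      Function.surjInv_eq hφ, Function.surjInv_eq hφ] at h''
    subst h''
    have := mul_left_cancel h'
    subst this
    rfl
  · rintro ⟨g, hg⟩
    refine ⟨⟨⟨(Function.surjInv hφ (φ g))⁻¹ * g, ?_⟩, ⟨φ g, hg⟩⟩, ?_⟩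
    · rw [MonoidHom.mem_ker, map_mul, map_inv, Function.surjInv_eq hφ, inv_mul_cancel]
    · simp

lemma sum_comp_surj {Q : Type} [Group Q] [Fintype G] [Fintype Q] (φ : G →* Q)
    (hφ : Function.Surjective φ) (F : Q → ℂ) : ∑ g, F (φ g) = Nat.card φ.ker * ∑ q, F q := by
  rw [← Finset.sum_fiberwise (g := φ), Finset.mul_sum]
  refine Finset.sum_congr rfl fun q _ => ?_
  have h1 : ∀ g ∈ Finset.univ.filter (fun g => φ g = q), F (φ g) = F q := by
    intro g hg; rw [(Finset.mem_filter.1 hg).2]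
  rw [Finset.sum_congr rfl h1]
  have h2 := card_comp_surj φ hφ {q}
  have h3 : Nat.card (φ ⁻¹' {q}) = (Finset.univ.filter (fun g => φ g = q)).card := by
    rw [Nat.card_eq_fintype_card, Fintype.card_subtype]
    rfl
  rw [h3] at h2
  rw [Finset.sum_const, h2]
  simp

lemma irr_comp_surj {Q : Type} [Group Q] [Finite G] (φ : G →* Q)
    (hφ : Function.Surjective φ) {χ : Q → ℂ} (hχ : IsIrrChar Q χ) :
    IsIrrChar G (fun g => χ (φ g)) ∧ codeg (fun g => χ (φ g)) = codeg χ := by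
  have : Finite Q := Finite.of_surjective φ hφ
  cases nonempty_fintype G
  cases nonempty_fintype Q
  have hc : Nat.card G = Nat.card φ.ker * Nat.card Q := by
    have := card_comp_surj φ hφ Set.univ
    simpa using this
  have hk : (Nat.card φ.ker : ℂ) ≠ 0 := by exact_mod_cast Nat.card_pos.ne'
  constructor
  · refine isIrr_iff.2 ⟨hχ.isChar.comp φ, ?_⟩
    have := sum_comp_surj φ hφ (fun q => χ q * χ q⁻¹)
    simp only [map_inv]
    rw [this, (isIrr_iff.1 hχ).2, hc]
    push_cast; rfl
  · have h1 : charKer (fun g => χ (φ g)) = φ ⁻¹' (charKer χ) := by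
      ext g; simp [charKer]
    simp only [codeg]
    rw [h1, card_comp_surj φ hφ, hc, map_one]
    push_cast
    rw [mul_div_mul_left _ _ hk]

lemma codSet_surj {Q : Type} [Group Q] [Finite G] (φ : G →* Q)
    (hφ : Function.Surjective φ) : codSet Q ⊆ codSet G := by
  rintro c ⟨χ, hχ, rfl⟩
  obtain ⟨h1, h2⟩ := irr_comp_surj φ hφ hχ
  exact ⟨_, h1, h2⟩

lemma codeg_lin [Finite G] (l : G →* ℂˣ) : codeg (fun x => (l x : ℂ)) = orderOf l := by
  have h1 : charKer (fun x => (l x : ℂ)) = (l.ker : Set G) := by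
    ext g; simp [charKer, MonoidHom.mem_ker]
  have h2 : Nat.card l.ker * Nat.card l.range = Nat.card G := by
    rw [← Subgroup.index_ker, Subgroup.card_mul_index]
  have h3 : Nat.card l.range = orderOf l := by
    have : Finite l.range := Set.finite_range l
    have hcyc : IsCyclic l.range := inferInstance
    rw [← IsCyclic.exponent_eq_card]
    apply Nat.dvd_antisymm
    · apply Monoid.exponent_dvd_of_forall_pow_eq_one
      rintro ⟨_, x, rfl⟩
      apply Subtype.ext
      exact congrArg (fun f : G →* ℂˣ => f x) (pow_orderOf_eq_one l)
    · apply orderOf_dvd_of_pow_eq_one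
      ext x
      have := Monoid.pow_exponent_eq_one (⟨l x, x, rfl⟩ : l.range)
      have := congrArg Subtype.val this
      simpa using congrArg Units.val this
  have hk : (Nat.card l.ker : ℂ) ≠ 0 := by exact_mod_cast Nat.card_pos.ne'
  rw [codeg, h1, ← h2, ← h3]
  push_cast
  simp only [map_one, Units.val_one, div_one]
  exact mul_div_cancel_left₀ _ hk

end Regular


section Simple
variable {G : Type} [Group G] [Fintype G]

lemma dg_one : dg (1 : G → ℂ) = 1 := by simp [dg]

lemma dg_mul {f g : G → ℂ} (hf : IsChar G f) (hg : IsChar G g) : dg (f * g) = dg f * dg g := by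
  have h := (hf.mul hg).one_eq
  rw [Pi.mul_apply, hf.one_eq, hg.one_eq] at h
  exact_mod_cast h.symm

lemma dg_inv {f : G → ℂ} : dg (fun x => f x⁻¹) = dg f := by simp [dg]

lemma deg_sum {f : G → ℂ} (hf : IsChar G f) {m : (G → ℂ) → ℕ}
    (hm : f = ∑ χ ∈ irrF G, (m χ : ℂ) • χ) : dg f = ∑ χ ∈ irrF G, m χ * dg χ := by
  have h := hf.one_eq
  rw [hm, Finset.sum_apply] at h
  have : ∀ χ ∈ irrF G, ((m χ : ℂ) • χ) 1 = ((m χ * dg χ : ℕ) : ℂ) := by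
    intro χ hχ
    rw [Pi.smul_apply, (mem_irrF.1 hχ).isChar.one_eq]
    push_cast; rfl
  rw [Finset.sum_congr rfl this, ← hm] at h
  exact_mod_cast h.symm

lemma exists_irr_ne_one [Nontrivial G] : ∃ χ : G → ℂ, IsIrrChar G χ ∧ χ ≠ 1 := by
  by_contra hcon
  push Not at hcon
  have h := sum_sq_all (G := G)
  have h2 : irrF G = {1} := by
    ext χ
    rw [mem_irrF, Finset.mem_singleton]
    exact ⟨hcon χ, fun h => h ▸ irr_one⟩
  rw [h2, Finset.sum_singleton, dg_one] at h
  have := Finite.one_lt_card (α := G)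
  omega

lemma lemmaT [Nontrivial G] (p : ℕ) (hp : p.Prime)
    (h : ∀ χ : G → ℂ, IsIrrChar G χ → χ ≠ 1 → p ∣ dg χ) : False := by
  obtain ⟨θ, hθ, hθ1⟩ := exists_irr_ne_one (G := G)
  have hf : IsChar G (θ * fun x => θ x⁻¹) := hθ.isChar.mul hθ.isChar.inv
  obtain ⟨m, h1, h2⟩ := hf.decomp
  have h3 := deg_sum hf h1
  rw [dg_mul hθ.isChar hθ.isChar.inv, dg_inv] at h3
  have h4 : m 1 = 1 := by
    have := h2 1 irr_one
    have h5 : ip (θ * fun x => θ x⁻¹) 1 = ip θ θ := by simp [ip]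
    rw [h5, (irr_iff_ip.1 hθ).2] at this
    exact_mod_cast this
  rw [← Finset.add_sum_erase _ _ (mem_irrF.2 irr_one), h4, dg_one] at h3
  have h5 : p ∣ ∑ χ ∈ (irrF G).erase 1, m χ * dg χ := by
    refine Finset.dvd_sum fun χ hχ => ?_
    rw [Finset.mem_erase, mem_irrF] at hχ
    exact Dvd.dvd.mul_left (h χ hχ.2 hχ.1) _
  have h6 : p ∣ dg θ * dg θ := Dvd.dvd.mul_left (h θ hθ hθ1) _
  rw [h3] at h6
  have := (Nat.dvd_add_left h5).1 h6
  exact hp.one_lt.ne' (Nat.dvd_one.1 (by simpa using this))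

lemma split_deg {a b : ℕ} (hab : a ≠ b) (ha : 1 < a) (hb : 1 < b)
    (h : ∀ χ : G → ℂ, IsIrrChar G χ → χ ≠ 1 → dg χ = a ∨ dg χ = b)
    {f : G → ℂ} (hf : IsChar G f) {m : (G → ℂ) → ℕ}
    (hm : f = ∑ χ ∈ irrF G, (m χ : ℂ) • χ) :
    dg f = m 1 + a * ∑ χ ∈ irrF G with dg χ = a, m χ + b * ∑ χ ∈ irrF G with dg χ = b, m χ := by
  rw [deg_sum hf hm, ← Finset.add_sum_erase _ _ (mem_irrF.2 irr_one), dg_one, mul_one, add_assoc]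
  congr 1
  rw [← Finset.sum_filter_add_sum_filter_not _ (fun χ => dg χ = a)]
  congr 1
  · rw [Finset.mul_sum]
    have : (irrF G).filter (fun χ => dg χ = a) = ((irrF G).erase 1).filter (fun χ => dg χ = a) := by
      ext χ
      simp only [Finset.mem_filter, Finset.mem_erase]
      refine ⟨fun ⟨h1, h2⟩ => ⟨⟨fun h3 => ?_, h1⟩, h2⟩, fun ⟨⟨_, h1⟩, h2⟩ => ⟨h1, h2⟩⟩
      rw [h3, dg_one] at h2; omega
    rw [this]
    refine Finset.sum_congr rfl fun χ hχ => ?_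
    rw [(Finset.mem_filter.1 hχ).2, mul_comm]
  · rw [Finset.mul_sum]
    have : (irrF G).filter (fun χ => dg χ = b) =
        ((irrF G).erase 1).filter (fun χ => ¬ dg χ = a) := by
      ext χ
      simp only [Finset.mem_filter, Finset.mem_erase]
      constructor
      · rintro ⟨h1, h2⟩
        refine ⟨⟨fun h3 => ?_, h1⟩, ?_⟩
        · rw [h3, dg_one] at h2; omega
        · rw [h2]; exact hab.symm
      · rintro ⟨⟨h0, h1⟩, h2⟩
        exact ⟨h1, (h χ (mem_irrF.1 h1) h0).resolve_left h2⟩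
    rw [this]
    refine Finset.sum_congr rfl fun χ hχ => ?_
    rw [← this] at hχ
    rw [(Finset.mem_filter.1 hχ).2, mul_comm]

lemma lemmaSimple_aux [Nontrivial G] {a b : ℕ} (hab : a < b) (ha : 1 < a)
    (h : ∀ χ : G → ℂ, IsIrrChar G χ → χ ≠ 1 → dg χ = a ∨ dg χ = b) : False := by
  have hcop : Nat.Coprime a b := by
    by_contra hc
    obtain ⟨p, hp, h1, h2⟩ := Nat.Prime.not_coprime_iff_dvd.1 hc
    refine lemmaT (G := G) p hp fun χ hχ h3 => ?_
    rcases h χ hχ h3 with h4 | h4 <;> rw [h4] <;> assumption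
  have hexa : ∃ α : G → ℂ, IsIrrChar G α ∧ dg α = a := by
    by_contra hcon
    push Not at hcon
    obtain ⟨p, hp, h1⟩ := Nat.exists_prime_and_dvd (n := b) (by omega)
    refine lemmaT (G := G) p hp fun χ hχ h3 => ?_
    rcases h χ hχ h3 with h4 | h4
    · exact absurd h4 (hcon χ hχ)
    · rwa [h4]
  obtain ⟨α, hα, hαa⟩ := hexa
  have hsp := fun {f : G → ℂ} (hf : IsChar G f) {m : (G → ℂ) → ℕ}
    (hm : f = ∑ χ ∈ irrF G, (m χ : ℂ) • χ) => split_deg hab.ne ha (by omega) h hf hm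
  -- first product
  have hf : IsChar G (α * fun x => α x⁻¹) := hα.isChar.mul hα.isChar.inv
  obtain ⟨m, h1, h2⟩ := hf.decomp
  have h3 := hsp hf h1
  rw [dg_mul hα.isChar hα.isChar.inv, dg_inv, hαa] at h3
  have h4 : m 1 = 1 := by
    have := h2 1 irr_one
    have h5 : ip (α * fun x => α x⁻¹) 1 = ip α α := by simp [ip]
    rw [h5, (irr_iff_ip.1 hα).2] at this
    exact_mod_cast this
  have hβ : ∃ β ∈ (irrF G).filter (fun χ => dg χ = b), m β ≠ 0 := by
    by_contra hcon
    push Not at hcon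
    rw [Finset.sum_eq_zero hcon, mul_zero, add_zero, h4] at h3
    have : a ∣ 1 := by
      have h6 : a ∣ a * a := dvd_mul_right _ _
      rw [h3] at h6
      exact (Nat.dvd_add_left (dvd_mul_right _ _)).1 h6
    exact ha.ne' (Nat.dvd_one.1 this)
  obtain ⟨β, hβ, hn0⟩ := hβ
  rw [Finset.mem_filter, mem_irrF] at hβ
  obtain ⟨hβ, hβb⟩ := hβ
  -- bound
  have hbound : b * m β ≤ a * a := by
    have : m β ≤ ∑ χ ∈ irrF G with dg χ = b, m χ :=
      Finset.single_le_sum (f := m) (fun _ _ => Nat.zero_le _)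
        (Finset.mem_filter.2 ⟨mem_irrF.2 hβ, hβb⟩)
    have := Nat.mul_le_mul_left b this
    omega
  -- second product
  have hg : IsChar G (α * fun x => β x⁻¹) := hα.isChar.mul hβ.isChar.inv
  obtain ⟨k, k1, k2⟩ := hg.decomp
  have k3 := hsp hg k1
  rw [dg_mul hα.isChar hβ.isChar.inv, dg_inv, hαa, hβb] at k3
  have hαβ : α ≠ β := fun hh => by rw [hh] at hαa; omega
  have k4 : k 1 = 0 := by
    have := k2 1 irr_one
    have h5 : ip (α * fun x => β x⁻¹) 1 = ip α β := by simp [ip]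
    rw [h5, ip_orth hα hβ, if_neg hαβ] at this
    exact_mod_cast this
  have k5 : k α = m β := by
    have e1 := k2 α hα
    have e2 := h2 β hβ
    have e3 : ip (α * fun x => β x⁻¹) α = ip (α * fun x => α x⁻¹) β := by
      simp only [ip, Pi.mul_apply]
      congr 1
      exact Finset.sum_congr rfl fun x _ => by ring
    rw [e3, ← e2] at e1
    exact_mod_cast e1
  have k6 : ∀ α' ∈ (irrF G).filter (fun χ => dg χ = a), α' ≠ α → k α' = 0 := by
    intro α' hα' hne
    rw [Finset.mem_filter, mem_irrF] at hα'
    obtain ⟨hα', hα'a⟩ := hα'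
    have hj : IsChar G (α * fun x => α' x⁻¹) := hα.isChar.mul hα'.isChar.inv
    obtain ⟨j, j1, j2⟩ := hj.decomp
    have j3 := hsp hj j1
    rw [dg_mul hα.isChar hα'.isChar.inv, dg_inv, hαa, hα'a] at j3
    have j4 : j 1 = 0 := by
      have := j2 1 irr_one
      have h5 : ip (α * fun x => α' x⁻¹) 1 = ip α α' := by simp [ip]
      rw [h5, ip_orth hα hα', if_neg hne.symm] at this
      exact_mod_cast this
    have j5 : k α' = j β := by
      have e1 := k2 α' hα'
      have e2 := j2 β hβ
      have e3 : ip (α * fun x => β x⁻¹) α' = ip (α * fun x => α' x⁻¹) β := by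
        simp only [ip, Pi.mul_apply]
        congr 1
        exact Finset.sum_congr rfl fun x _ => by ring
      rw [e3, ← e2] at e1
      exact_mod_cast e1
    rw [j4, zero_add] at j3
    set S := ∑ χ ∈ irrF G with dg χ = b, j χ with hS
    have j6 : a ∣ b * S := by
      have h6 : a ∣ a * a := dvd_mul_right _ _
      rw [j3] at h6
      exact (Nat.dvd_add_right (dvd_mul_right _ _)).1 h6
    have j7 : a ∣ S := hcop.dvd_of_dvd_mul_left j6
    have j8 : S = 0 := by
      by_contra hS0
      have := Nat.le_of_dvd (Nat.pos_of_ne_zero hS0) j7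
      have h9 : b * a ≤ b * S := Nat.mul_le_mul_left b this
      have h10 : a * a < b * a := Nat.mul_lt_mul_of_pos_right hab (by omega)
      omega
    rw [j5]
    exact (Finset.sum_eq_zero_iff.1 j8) β (Finset.mem_filter.2 ⟨mem_irrF.2 hβ, hβb⟩)
  rw [k4, zero_add, Finset.sum_eq_single_of_mem α (Finset.mem_filter.2 ⟨mem_irrF.2 hα, hαa⟩) k6,
    k5] at k3
  have k7 : b ∣ a * m β := by
    have h6 : b ∣ a * b := dvd_mul_left _ _
    rw [k3] at h6
    exact (Nat.dvd_add_left (dvd_mul_right _ _)).1 h6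
  have k8 : b ∣ m β := hcop.symm.dvd_of_dvd_mul_left k7
  have k9 := Nat.le_of_dvd (Nat.pos_of_ne_zero hn0) k8
  have k10 : b * b ≤ b * m β := Nat.mul_le_mul_left b k9
  have k11 : a * a < b * b := Nat.mul_self_lt_mul_self hab
  omega

lemma lemmaSimple [Nontrivial G] {a b : ℕ} (ha : 1 < a) (hb : 1 < b)
    (h : ∀ χ : G → ℂ, IsIrrChar G χ → χ ≠ 1 → dg χ = a ∨ dg χ = b) : False := by
  rcases lt_trichotomy a b with hab | hab | hab
  · exact lemmaSimple_aux hab ha h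
  · obtain ⟨p, hp, h1⟩ := Nat.exists_prime_and_dvd (n := b) (by omega)
    refine lemmaT (G := G) p hp fun χ hχ h3 => ?_
    rcases h χ hχ h3 with h4 | h4
    · rwa [h4, hab]
    · rwa [h4]
  · exact lemmaSimple_aux hab hb fun χ h1 h2 => (h χ h1 h2).symm

end Simple


section Mono
variable {G : Type} [Group G] {V : Type} [AddCommGroup V] [Module ℂ V] [FiniteDimensional ℂ V]

lemma sum_finrank_le {ι : Type*} [Fintype ι] (p : ι → Submodule ℂ V) (hp : iSupIndep p)
    (U : Submodule ℂ V) (hU : ∀ i, p i ≤ U) :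
    ∑ i, Module.finrank ℂ (p i) ≤ Module.finrank ℂ U := by
  have key : ∀ s : Finset ι, ∑ i ∈ s, Module.finrank ℂ (p i) = Module.finrank ℂ (s.sup p : Submodule ℂ V) := by
    intro s
    induction s using Finset.induction_on with
    | empty => rw [Finset.sup_empty, finrank_bot, Finset.sum_empty]
    | insert a s ha ih =>
      rw [Finset.sum_insert ha, Finset.sup_insert, ih]
      have hd : Disjoint (p a) (s.sup p) := by
        rw [Finset.sup_eq_iSup]
        exact hp.disjoint_biSup (y := (s : Set ι)) ha
      have := Submodule.finrank_sup_add_finrank_inf_eq (p a) (s.sup p)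
      rw [hd.eq_bot, finrank_bot, add_zero] at this
      exact this.symm
  rw [key]
  exact Submodule.finrank_mono (Finset.sup_le fun i _ => hU i)

/-- simultaneous eigenspaces -/
def wt (ρ : Representation ℂ G V) (S : Set G) (χ : S → ℂ) : Submodule ℂ V :=
  ⨅ s : S, Module.End.eigenspace (ρ s) (χ s)

lemma mem_wt (ρ : Representation ℂ G V) (S : Set G) (χ : S → ℂ) (v : V) :
    v ∈ wt ρ S χ ↔ ∀ s : S, ρ s v = χ s • v := by
  simp [wt, Module.End.mem_eigenspace_iff]

lemma wt_indep (ρ : Representation ℂ G V) (S : Set G) (hS : ∀ s ∈ S, ∀ t ∈ S, s * t = t * s) :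
    iSupIndep (wt ρ S) := by
  have := Module.End.independent_iInf_maxGenEigenspace_of_forall_mapsTo (fun s : S => ρ s)
    (by
      intro i j φ
      apply Module.End.mapsTo_maxGenEigenspace_of_comm
      change ρ _ * ρ _ = ρ _ * ρ _
      rw [← map_mul, ← map_mul, hS _ j.2 _ i.2])
  refine this.mono fun χ => ?_
  exact iInf_mono fun s => Module.End.eigenspace_le_maxGenEigenspace

lemma exists_wt (ρ : Representation ℂ G V) (S : Set G) (hS : ∀ s ∈ S, ∀ t ∈ S, s * t = t * s)
    (U : Submodule ℂ V) (hU : ∀ s ∈ S, ∀ u ∈ U, ρ s u ∈ U) (hU0 : U ≠ ⊥) :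
    ∃ χ : S → ℂ, U ⊓ wt ρ S χ ≠ ⊥ := by
  induction hn : Module.finrank ℂ U using Nat.strong_induction_on generalizing U with
  | _ n ih =>
    by_cases h : ∀ s : S, ∃ c : ℂ, ∀ u ∈ U, ρ s u = c • u
    · choose χ hχ using h
      refine ⟨χ, ?_⟩
      have : U ≤ wt ρ S χ := fun u hu => (mem_wt ρ S χ u).2 fun s => hχ s u hu
      rwa [inf_eq_left.2 this]
    · push Not at h
      obtain ⟨s, hs⟩ := h
      have hnt : Nontrivial U := (Submodule.nontrivial_iff_ne_bot).2 hU0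
      obtain ⟨c, hc⟩ := Module.End.exists_eigenvalue ((ρ s).restrict (hU s s.2))
      obtain ⟨w, hw⟩ := hc.exists_hasEigenvector
      have hw1 : ρ s w = c • (w : V) := congrArg Subtype.val hw.apply_eq_smul
      let U' := U ⊓ Module.End.eigenspace (ρ s) c
      have h1 : U' ≠ ⊥ := by
        intro hb
        have : (w : V) ∈ U' := ⟨w.2, Module.End.mem_eigenspace_iff.2 hw1⟩
        rw [hb] at this
        exact hw.2 (Subtype.ext ((Submodule.mem_bot ℂ).1 this))
      have h2 : U' < U := by
        refine lt_of_le_of_ne inf_le_left fun he => ?_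
        obtain ⟨u, hu, hu2⟩ := hs c
        rw [← he] at hu
        exact hu2 (Module.End.mem_eigenspace_iff.1 hu.2)
      obtain ⟨χ, hχ⟩ := ih (Module.finrank ℂ U') (hn ▸ Submodule.finrank_lt_finrank_of_lt h2) U'
        (by
          intro t ht u hu
          refine ⟨hU t ht u hu.1, Module.End.mem_eigenspace_iff.2 ?_⟩
          rw [← Module.End.mul_apply, ← map_mul, hS _ s.2 _ ht, map_mul, Module.End.mul_apply,
            Module.End.mem_eigenspace_iff.1 hu.2, map_smul]) h1 rfl
      exact ⟨χ, fun hb => hχ (le_bot_iff.1 (hb ▸ inf_le_inf_right _ h2.le))⟩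

lemma span_translates (ρ : Representation ℂ G V) (hρ : IrrRep ρ) (H : Subgroup G) (v : V)
    (hv : v ≠ 0) (hH : ∀ h ∈ H, ∃ c : ℂ, ρ h v = c • v) :
    ⊤ ≤ Submodule.span ℂ (Set.range fun q : G ⧸ H => ρ q.out v) := by
  set W := Submodule.span ℂ (Set.range fun q : G ⧸ H => ρ q.out v) with hW
  have h1 : ∀ g, ρ g v ∈ W := by
    intro g
    obtain ⟨h, hh⟩ := QuotientGroup.mk_out_eq_mul H g
    obtain ⟨c, hc⟩ := hH (h⁻¹ : G) (H.inv_mem h.2)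
    have : g = (Quotient.out (g : G ⧸ H)) * (h : G)⁻¹ := by rw [hh]; simp
    rw [this, map_mul, Module.End.mul_apply, hc, map_smul]
    exact Submodule.smul_mem _ _ (Submodule.subset_span ⟨(g : G ⧸ H), rfl⟩)
  have hinv : InvSub ρ W := by
    intro g w hw
    have : W ≤ W.comap (ρ g) := by
      conv_lhs => rw [hW]
      rw [Submodule.span_le]
      rintro _ ⟨q, rfl⟩
      simp only [Submodule.comap_coe, Set.mem_preimage, SetLike.mem_coe]
      rw [← Module.End.mul_apply, ← map_mul]
      exact h1 _
    exact this hw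
  rcases hρ.2 W hinv with h | h
  · exfalso
    have := h1 1
    rw [h] at this
    simp at this
    exact hv this
  · exact h.ge

lemma finrank_le_index [Finite G] (ρ : Representation ℂ G V) (hρ : IrrRep ρ) (H : Subgroup G) (v : V)
    (hv : v ≠ 0) (hH : ∀ h ∈ H, ∃ c : ℂ, ρ h v = c • v) : Module.finrank ℂ V ≤ H.index := by
  cases nonempty_fintype G
  have := span_translates ρ hρ H v hv hH
  have h2 := finrank_range_le_card (R := ℂ) (fun q : G ⧸ H => ρ q.out v)
  rw [Set.finrank, top_le_iff.1 this, finrank_top] at h2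
  rwa [Subgroup.index, Nat.card_eq_fintype_card]

lemma exists_lam (ρ : Representation ℂ G V) (H : Subgroup G) (v : V)
    (hv : v ≠ 0) (hH : ∀ h ∈ H, ∃ c : ℂ, ρ h v = c • v) :
    ∃ lam : H →* ℂ, ∀ h : H, ρ h v = lam h • v := by
  choose c hc using fun h : H => hH h h.2
  have hinj : ∀ a b : ℂ, a • v = b • v → a = b := fun a b hab => by
    exact smul_left_injective ℂ hv hab
  refine ⟨{ toFun := c, map_one' := ?_, map_mul' := ?_ }, hc⟩
  · apply hinj
    rw [← hc]; simp
  · intro a b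
    apply hinj
    rw [← hc, Subgroup.coe_mul, map_mul, Module.End.mul_apply, hc b, map_smul, hc a, smul_smul,
      mul_comm]

lemma sum_quot [Fintype G] (H : Subgroup G) (F : G → ℂ) (hF : ∀ x, ∀ h ∈ H, F (x * h) = F x) :
    ∑ x, F x = (Nat.card H : ℂ) * ∑ q : G ⧸ H, F q.out := by
  have e : Function.Bijective (fun y : (G ⧸ H) × H => y.1.out * (y.2 : G)) := by
    constructor
    · rintro ⟨q, h⟩ ⟨q', h'⟩ he
      simp only at he
      have h1 := congrArg (fun x : G => (x : G ⧸ H)) he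
      simp only [QuotientGroup.mk_mul_of_mem _ h.2, QuotientGroup.mk_mul_of_mem _ h'.2,
        QuotientGroup.out_eq'] at h1
      subst h1
      have := mul_left_cancel he
      rw [Subtype.ext this]
    · intro g
      obtain ⟨h, hh⟩ := QuotientGroup.mk_out_eq_mul H g
      exact ⟨⟨(g : G ⧸ H), h⁻¹⟩, by simp [hh]⟩
  rw [← Equiv.sum_comp (Equiv.ofBijective _ e), Fintype.sum_prod_type, Finset.mul_sum]
  refine Finset.sum_congr rfl fun q _ => ?_
  have : ∀ h : H, F (Equiv.ofBijective _ e (q, h)) = F q.out := fun h => hF _ _ h.2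
  rw [Finset.sum_congr rfl fun h _ => this h]
  simp

lemma mono_crit [Finite G] (ρ : Representation ℂ G V) (hρ : IrrRep ρ) (H : Subgroup G) (v : V)
    (hv : v ≠ 0) (hH : ∀ h ∈ H, ∃ c : ℂ, ρ h v = c • v) (hi : H.index ≤ Module.finrank ℂ V) :
    IsMonomialChar ρ.character ∧ Module.finrank ℂ V = H.index := by
  have heq := le_antisymm (finrank_le_index ρ hρ H v hv hH) hi
  refine ⟨?_, heq⟩
  cases nonempty_fintype G
  obtain ⟨lam, hlam⟩ := exists_lam ρ H v hv hH
  refine ⟨H, lam, ?_⟩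
  have hcard : Fintype.card (G ⧸ H) = Module.finrank ℂ V := by
    rw [heq, Subgroup.index, Nat.card_eq_fintype_card]
  let b := basisOfTopLeSpanOfCardEqFinrank (fun q : G ⧸ H => ρ q.out v)
    (span_translates ρ hρ H v hv hH) hcard
  have hb : ∀ q, b q = ρ q.out v := fun q => by simp [b]
  funext g
  let F : G → ℂ := fun x => if h : x⁻¹ * g * x ∈ H then lam ⟨x⁻¹ * g * x, h⟩ else 0
  have hF : ∀ x, ∀ h ∈ H, F (x * h) = F x := by
    intro x h hh
    have e1 : (x * h)⁻¹ * g * (x * h) = h⁻¹ * (x⁻¹ * g * x) * h := by group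
    by_cases hx : x⁻¹ * g * x ∈ H
    · have hx' : (x * h)⁻¹ * g * (x * h) ∈ H := by
        rw [e1]; exact H.mul_mem (H.mul_mem (H.inv_mem hh) hx) hh
      simp only [F, dif_pos hx, dif_pos hx']
      have : (⟨(x * h)⁻¹ * g * (x * h), hx'⟩ : H) = ⟨h, hh⟩⁻¹ * ⟨x⁻¹ * g * x, hx⟩ * ⟨h, hh⟩ :=
        Subtype.ext e1
      rw [this, map_mul, map_mul, mul_right_comm, ← map_mul]
      simp
    · have hx' : (x * h)⁻¹ * g * (x * h) ∉ H := by
        rw [e1]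
        intro hc
        apply hx
        have := H.mul_mem (H.mul_mem hh hc) (H.inv_mem hh)
        convert this using 1
        group
      simp only [F, dif_neg hx, dif_neg hx']
  have h1 : indChar H (⇑lam) g = ∑ q : G ⧸ H, F q.out := by
    have hc : (Nat.card H : ℂ) ≠ 0 := by exact_mod_cast Nat.card_pos.ne'
    have : ∑ᶠ x : G, F x = ∑ x, F x := finsum_eq_sum_of_fintype _
    change (Nat.card H : ℂ)⁻¹ * ∑ᶠ x : G, F x = _
    rw [this, sum_quot H F hF, inv_mul_cancel_left₀ hc]
  rw [h1, Representation.character, LinearMap.trace_eq_matrix_trace ℂ b, Matrix.trace]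
  refine Finset.sum_congr rfl fun q _ => ?_
  rw [Matrix.diag_apply, LinearMap.toMatrix_apply, hb, ← Module.End.mul_apply, ← map_mul]
  obtain ⟨h, hh⟩ := QuotientGroup.mk_out_eq_mul H (g * q.out)
  set q' : G ⧸ H := ((g * q.out : G) : G ⧸ H) with hq'
  have e2 : g * q.out = q'.out * ((h⁻¹ : H) : G) := by rw [hh]; simp
  rw [e2, map_mul, Module.End.mul_apply, hlam, map_smul, ← hb, map_smul, Module.Basis.repr_self]
  by_cases hqq : q' = q
  · rw [hqq] at e2 ⊢
    have e3 : q.out⁻¹ * g * q.out = ((h⁻¹ : H) : G) := by rw [mul_assoc, e2]; simp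
    have hx : q.out⁻¹ * g * q.out ∈ H := by rw [e3]; exact (h⁻¹ : H).2
    simp only [F, dif_pos hx]
    have : (⟨q.out⁻¹ * g * q.out, hx⟩ : H) = h⁻¹ := Subtype.ext e3
    rw [this]
    simp
  · have hx : q.out⁻¹ * g * q.out ∉ H := by
      intro hx
      apply hqq
      rw [hq']
      have : g * q.out = q.out * (q.out⁻¹ * g * q.out) := by group
      rw [this, QuotientGroup.mk_mul_of_mem _ hx, QuotientGroup.out_eq']
    simp only [F, dif_neg hx]
    simp [hqq]

end Mono


section MLemma
variable {G : Type} [Group G] [Finite G] {V : Type} [AddCommGroup V] [Module ℂ V]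
  [FiniteDimensional ℂ V]

lemma exists_min_inv (ρ : Representation ℂ G V) (H : Subgroup G) (W : Submodule ℂ V)
    (hW : ∀ h ∈ H, ∀ w ∈ W, ρ h w ∈ W) (hW0 : W ≠ ⊥) :
    ∃ U ≤ W, U ≠ ⊥ ∧ (∀ h ∈ H, ∀ w ∈ U, ρ h w ∈ U) ∧
      ∀ U' ≤ U, (∀ h ∈ H, ∀ w ∈ U', ρ h w ∈ U') → U' = ⊥ ∨ U' = U := by
  induction hn : Module.finrank ℂ W using Nat.strong_induction_on generalizing W with
  | _ n ih =>
    by_cases h : ∀ U' ≤ W, (∀ h ∈ H, ∀ w ∈ U', ρ h w ∈ U') → U' = ⊥ ∨ U' = W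
    · exact ⟨W, le_rfl, hW0, hW, h⟩
    · push Not at h
      obtain ⟨U', h1, h2, h3, h4⟩ := h
      have hlt : U' < W := lt_of_le_of_ne h1 h4
      obtain ⟨U, a, b⟩ := ih _ (hn ▸ Submodule.finrank_lt_finrank_of_lt hlt) U' h2 h3 rfl
      exact ⟨U, a.trans h1, b⟩

/-- `ρ g W` -/
lemma map_one_rep (ρ : Representation ℂ G V) (W : Submodule ℂ V) : W.map (ρ 1) = W := by
  rw [map_one]; exact Submodule.map_id W

lemma map_mul_rep (ρ : Representation ℂ G V) (W : Submodule ℂ V) (g h : G) :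
    W.map (ρ (g * h)) = (W.map (ρ h)).map (ρ g) := by
  rw [map_mul]; exact Submodule.map_comp _ _ _

lemma finrank_map_rep (ρ : Representation ℂ G V) (W : Submodule ℂ V) (g : G) :
    Module.finrank ℂ (W.map (ρ g)) = Module.finrank ℂ W := by
  apply le_antisymm
  · exact Submodule.finrank_map_le _ _
  · have h := Submodule.finrank_map_le (ρ g⁻¹) (W.map (ρ g))
    rwa [← map_mul_rep, inv_mul_cancel, map_one_rep] at h

lemma center_elt (p : ℕ) [hp : Fact p.Prime] (H : Subgroup G) (Z : Subgroup G) (hZH : Z ≤ H)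
    (hZn : ∀ h ∈ H, ∀ z ∈ Z, h⁻¹ * z * h ∈ Z) (hpow : ∀ h ∈ H, ∃ k : ℕ, h ^ p ^ k ∈ Z)
    (hne : ∃ h ∈ H, h ∉ Z) : ∃ x ∈ H, x ∉ Z ∧ ∀ h ∈ H, (h⁻¹ * x * h) * x⁻¹ ∈ Z := by
  have hnor : (Z.subgroupOf H).Normal := by
    constructor
    intro n hn g
    rw [Subgroup.mem_subgroupOf] at hn ⊢
    have := hZn (g⁻¹ : H) (g⁻¹ : H).2 _ hn
    simpa using this
  have hpg : IsPGroup p (H ⧸ Z.subgroupOf H) := by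
    intro q
    obtain ⟨h, rfl⟩ := QuotientGroup.mk_surjective q
    obtain ⟨k, hk⟩ := hpow h h.2
    refine ⟨k, ?_⟩
    rw [← QuotientGroup.mk_pow, QuotientGroup.eq_one_iff, Subgroup.mem_subgroupOf]
    simpa using hk
  obtain ⟨h0, hh0, hz0⟩ := hne
  have hnt : Nontrivial (H ⧸ Z.subgroupOf H) := by
    refine ⟨⟨((⟨h0, hh0⟩ : H) : H ⧸ Z.subgroupOf H), 1, fun he => ?_⟩⟩
    rw [QuotientGroup.eq_one_iff, Subgroup.mem_subgroupOf] at he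
    exact hz0 he
  have := hpg.center_nontrivial
  obtain ⟨⟨c, hc⟩, hc1⟩ := exists_ne (1 : Subgroup.center (H ⧸ Z.subgroupOf H))
  obtain ⟨x, rfl⟩ := QuotientGroup.mk_surjective c
  refine ⟨x, x.2, fun hx => hc1 ?_, fun h hh => ?_⟩
  · apply Subtype.ext
    change ((x : H) : H ⧸ Z.subgroupOf H) = 1
    rw [QuotientGroup.eq_one_iff, Subgroup.mem_subgroupOf]
    exact hx
  · have h1 := Subgroup.mem_center_iff.1 hc (((⟨h, hh⟩ : H)) : H ⧸ Z.subgroupOf H)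
    have h2 : (((⟨h, hh⟩⁻¹ * x * ⟨h, hh⟩ * x⁻¹ : H)) : H ⧸ Z.subgroupOf H) = 1 := by
      simp only [QuotientGroup.mk_mul, QuotientGroup.mk_inv]
      rw [mul_assoc _ _ (((⟨h, hh⟩ : H)) : H ⧸ Z.subgroupOf H), ← h1]
      simp
    rw [QuotientGroup.eq_one_iff, Subgroup.mem_subgroupOf] at h2
    simpa using h2

lemma mstep (ρ : Representation ℂ G V) (H : Subgroup G) (U : Submodule ℂ V)
    (hU0 : U ≠ ⊥) (hU : ∀ h ∈ H, ∀ w ∈ U, ρ h w ∈ U)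
    (hmin : ∀ U' ≤ U, (∀ h ∈ H, ∀ w ∈ U', ρ h w ∈ U') → U' = ⊥ ∨ U' = U)
    (S : Set G) (hSH : ∀ s ∈ S, s ∈ H) (hS : ∀ s ∈ S, ∀ t ∈ S, s * t = t * s)
    (hconj : ∀ h ∈ H, ∀ s ∈ S, ∃ t ∈ S, ∃ c : ℂ, ∀ u ∈ U, ρ (h⁻¹ * s * h) u = c • ρ t u)
    (hns : ∃ s ∈ S, ¬ ∃ c : ℂ, ∀ u ∈ U, ρ s u = c • u) :
    ∃ (W : Submodule ℂ V) (H₀ : Subgroup G), W ≤ U ∧ W ≠ ⊥ ∧ W ≠ U ∧ H₀ ≤ H ∧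
      (∀ h ∈ H₀, ∀ w ∈ W, ρ h w ∈ W) ∧
      H₀.relIndex H * Module.finrank ℂ W ≤ Module.finrank ℂ U := by
  obtain ⟨χ, hχ⟩ := exists_wt ρ S hS U (fun s hs => hU s (hSH s hs)) hU0
  let fam : (S → ℂ) → Submodule ℂ V := fun χ => U ⊓ wt ρ S χ
  have hind : iSupIndep fam := (wt_indep ρ S hS).mono fun χ => inf_le_right
  set W := fam χ with hWdef
  have hW0 : W ≠ ⊥ := hχ
  -- translates of a weight space lie in weight spaces
  have htr : ∀ h ∈ H, ∀ ψ, ∃ ψ', (fam ψ).map (ρ h) ≤ fam ψ' := by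
    intro h hh ψ
    choose t ht c hc using hconj h hh
    refine ⟨fun s => c s s.2 * ψ ⟨t s s.2, ht s s.2⟩, ?_⟩
    rintro _ ⟨w, hw, rfl⟩
    refine ⟨hU h hh w hw.1, (mem_wt _ _ _ _).2 fun s => ?_⟩
    have e1 : (s : G) * h = h * (h⁻¹ * s * h) := by group
    rw [← Module.End.mul_apply, ← map_mul, e1, map_mul, Module.End.mul_apply, hc s s.2 w hw.1,
      (mem_wt _ _ _ _).1 hw.2 ⟨t s s.2, ht s s.2⟩, smul_smul, map_smul]
  have htr2 : ∀ h ∈ H, ∃ ψ', W.map (ρ h) = fam ψ' := by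
    intro h hh
    obtain ⟨ψ', h1⟩ := htr h hh χ
    refine ⟨ψ', le_antisymm h1 ?_⟩
    obtain ⟨ψ'', h2⟩ := htr h⁻¹ (H.inv_mem hh) ψ'
    have h3 : W ≤ fam ψ'' := by
      calc W = (W.map (ρ h)).map (ρ h⁻¹) := by rw [← map_mul_rep, inv_mul_cancel, map_one_rep]
        _ ≤ (fam ψ').map (ρ h⁻¹) := Submodule.map_mono h1
        _ ≤ _ := h2
    have h4 : ψ'' = χ := by
      by_contra hne
      have := hind.pairwiseDisjoint hne
      exact hW0 (le_bot_iff.1 (this h3 le_rfl))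
    rw [h4] at h2
    calc fam ψ' = ((fam ψ').map (ρ h⁻¹)).map (ρ h) := by
          rw [← map_mul_rep, mul_inv_cancel, map_one_rep]
      _ ≤ _ := Submodule.map_mono h2
  let H₀ : Subgroup G :=
    { carrier := {h | h ∈ H ∧ W.map (ρ h) = W}
      mul_mem' := fun {a b} ha hb => ⟨H.mul_mem ha.1 hb.1, by rw [map_mul_rep, hb.2, ha.2]⟩
      one_mem' := ⟨H.one_mem, map_one_rep _ _⟩
      inv_mem' := fun {a} ha => ⟨H.inv_mem ha.1, by
        conv_lhs => rw [← ha.2]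
        rw [← map_mul_rep, inv_mul_cancel, map_one_rep]⟩ }
  have hH₀ : H₀ ≤ H := fun h hh => hh.1
  refine ⟨W, H₀, inf_le_left, hW0, ?_, hH₀, ?_, ?_⟩
  · intro he
    obtain ⟨s, hs, hs2⟩ := hns
    refine hs2 ⟨χ ⟨s, hs⟩, fun u hu => ?_⟩
    rw [← he] at hu
    exact (mem_wt _ _ _ _).1 hu.2 ⟨s, hs⟩
  · intro h hh w hw
    rw [← hh.2]
    exact Submodule.mem_map_of_mem hw
  · choose ψ hψ using htr2
    cases nonempty_fintype G
    let Q := H ⧸ (H₀.subgroupOf H)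
    let f : Q → (S → ℂ) := fun q => ψ q.out q.out.2
    have hfW : ∀ q : Q, W.map (ρ (q.out : H)) = fam (f q) := fun q => hψ _ _
    have hf : Function.Injective f := by
      intro q q' hqq
      have h1 : W.map (ρ (q.out : H)) = W.map (ρ (q'.out : H)) := by rw [hfW, hfW, hqq]
      rw [← QuotientGroup.out_eq' q, ← QuotientGroup.out_eq' q', QuotientGroup.eq,
        Subgroup.mem_subgroupOf]
      refine ⟨(q.out⁻¹ * q'.out : H).2, ?_⟩
      rw [Subgroup.coe_mul, Subgroup.coe_inv, map_mul_rep, ← h1, ← map_mul_rep, inv_mul_cancel,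
        map_one_rep]
    have h2 := sum_finrank_le (fun q => fam (f q)) (hind.comp hf) U fun q => inf_le_left
    have h3 : ∀ q : Q, Module.finrank ℂ (fam (f q)) = Module.finrank ℂ W := fun q => by
      rw [← hfW, finrank_map_rep]
    rw [Finset.sum_congr rfl fun q _ => h3 q] at h2
    simp only [Finset.sum_const, smul_eq_mul, Finset.card_univ] at h2
    rw [Subgroup.relIndex, Subgroup.index, Nat.card_eq_fintype_card]
    exact h2

lemma mlemma_aux (ρ : Representation ℂ G V) (p : ℕ) [hp : Fact p.Prime] (A : Subgroup G)
    [hA : A.Normal] (hab : ∀ a ∈ A, ∀ b ∈ A, a * b = b * a) (hpA : ∀ g : G, ∃ k : ℕ, g ^ p ^ k ∈ A)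
    (n : ℕ) : ∀ (H : Subgroup G) (U : Submodule ℂ V), Module.finrank ℂ U = n → 
    U ≠ ⊥ → (∀ h ∈ H, ∀ w ∈ U, ρ h w ∈ U) →
    (∀ U' ≤ U, (∀ h ∈ H, ∀ w ∈ U', ρ h w ∈ U') → U' = ⊥ ∨ U' = U) →
    ∃ K ≤ H, ∃ v ∈ U, v ≠ 0 ∧ (∀ k ∈ K, ∃ c : ℂ, ρ k v = c • v) ∧
      K.relIndex H ≤ Module.finrank ℂ U := by
  induction n using Nat.strong_induction_on with
  | _ n ih =>
    intro H U hn hU0 hU hmin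
    have finish : ∀ (W : Submodule ℂ V) (H₀ : Subgroup G), W ≤ U → W ≠ ⊥ → W ≠ U → H₀ ≤ H → 
      (∀ h ∈ H₀, ∀ w ∈ W, ρ h w ∈ W) → 
      H₀.relIndex H * Module.finrank ℂ W ≤ Module.finrank ℂ U → 
      ∃ K ≤ H, ∃ v ∈ U, v ≠ 0 ∧ (∀ k ∈ K, ∃ c : ℂ, ρ k v = c • v) ∧
      K.relIndex H ≤ Module.finrank ℂ U := by
      intro W H₀ hWU hW0 hWU' hH₀ hWi hle
      obtain ⟨U₁, h1, h2, h3, h4⟩ := exists_min_inv ρ H₀ W hWi hW0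
      have h5 : Module.finrank ℂ U₁ ≤ Module.finrank ℂ W := Submodule.finrank_mono h1
      have h6 : Module.finrank ℂ W < Module.finrank ℂ U :=
        Submodule.finrank_lt_finrank_of_lt (lt_of_le_of_ne hWU hWU')
      obtain ⟨K, k1, v, k2, k3, k4, k5⟩ := ih _ (by omega) H₀ U₁ rfl h2 h3 h4
      refine ⟨K, k1.trans hH₀, v, hWU (h1 k2), k3, k4, ?_⟩
      rw [← Subgroup.relIndex_mul_relIndex K H₀ H k1 hH₀, mul_comm]
      exact (Nat.mul_le_mul_left _ (k5.trans h5)).trans hle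
    by_cases hc1 : ∃ s ∈ {s | s ∈ A ∧ s ∈ H}, ¬ ∃ c : ℂ, ∀ u ∈ U, ρ s u = c • u
    · obtain ⟨W, H₀, a1, a2, a3, a4, a5, a6⟩ := mstep ρ H U hU0 hU hmin {s | s ∈ A ∧ s ∈ H}
        (fun s hs => hs.2) (fun s hs t ht => hab s hs.1 t ht.1)
        (fun h hh s hs => ⟨h⁻¹ * s * h, ⟨by simpa using hA.conj_mem s hs.1 h⁻¹,
          H.mul_mem (H.mul_mem (H.inv_mem hh) hs.2) hh⟩, 1, fun u _ => by simp⟩) hc1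
      exact finish W H₀ a1 a2 a3 a4 a5 a6
    · push Not at hc1
      let Z : Subgroup G :=
        { carrier := {h | h ∈ H ∧ ∃ c : ℂ, ∀ u ∈ U, ρ h u = c • u}
          mul_mem' := by
            rintro a b ⟨ha, c, hc⟩ ⟨hb, d, hd⟩
            refine ⟨H.mul_mem ha hb, d * c, fun u hu => ?_⟩
            rw [map_mul, Module.End.mul_apply, hd u hu, map_smul, hc u hu, smul_smul]
          one_mem' := ⟨H.one_mem, 1, fun u _ => by simp⟩
          inv_mem' := by
            rintro a ⟨ha, c, hc⟩
            refine ⟨H.inv_mem ha, c⁻¹, fun u hu => ?_⟩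
            have h1 : ρ a (ρ a⁻¹ u) = u := by
              rw [← Module.End.mul_apply, ← map_mul, mul_inv_cancel, map_one]; rfl
            rw [hc _ (hU _ (H.inv_mem ha) u hu)] at h1
            by_cases h0 : c = 0
            · rw [h0, zero_smul] at h1
              rw [← h1]; simp
            · exact (eq_inv_smul_iff₀ h0).2 h1 }
      have hZH : Z ≤ H := fun h hh => hh.1
      have hZn : ∀ h ∈ H, ∀ z ∈ Z, h⁻¹ * z * h ∈ Z := by
        rintro h hh z ⟨hz, c, hc⟩
        refine ⟨H.mul_mem (H.mul_mem (H.inv_mem hh) hz) hh, c, fun u hu => ?_⟩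
        rw [map_mul, map_mul, Module.End.mul_apply, Module.End.mul_apply, hc _ (hU h hh u hu),
          map_smul, ← Module.End.mul_apply, ← map_mul, inv_mul_cancel, map_one]
        rfl
      have hpow : ∀ h ∈ H, ∃ k : ℕ, h ^ p ^ k ∈ Z := by
        intro h hh
        obtain ⟨k, hk⟩ := hpA h
        exact ⟨k, H.pow_mem hh _, hc1 _ ⟨hk, H.pow_mem hh _⟩⟩
      by_cases hne : ∃ h ∈ H, h ∉ Z
      · obtain ⟨x, hx, hxZ, hxc⟩ := center_elt p H Z hZH hZn hpow hne
        obtain ⟨W, H₀, a1, a2, a3, a4, a5, a6⟩ := mstep ρ H U hU0 hU hmin {x}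
          (fun s hs => by rw [hs]; exact hx) (fun s hs t ht => by rw [hs, ht])
          (by
            rintro h hh s rfl
            obtain ⟨_, c, hc⟩ := hxc h hh
            refine ⟨s, rfl, c, fun u hu => ?_⟩
            rw [← hc _ (hU s hx u hu), ← Module.End.mul_apply, ← map_mul]
            simp)
          ⟨x, rfl, fun h => hxZ ⟨hx, h⟩⟩
        exact finish W H₀ a1 a2 a3 a4 a5 a6
      · push Not at hne
        obtain ⟨v, hv, hv0⟩ := Submodule.exists_mem_ne_zero_of_ne_bot hU0
        refine ⟨H, le_rfl, v, hv, hv0, fun k hk => ?_, ?_⟩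
        · obtain ⟨_, c, hc⟩ := hne k hk
          exact ⟨c, hc v hv⟩
        · rw [Subgroup.relIndex_self]
          rw [Nat.one_le_iff_ne_zero]
          exact fun h => hU0 (Submodule.finrank_eq_zero.1 h)

/-- The conclusion of the main structural claim. -/
def XP (p : ℕ) (G : Type) [Group G] : Prop :=
  ∃ A : Subgroup G, A.Normal ∧ (∀ a ∈ A, ∀ b ∈ A, a * b = b * a) ∧ ∀ g : G, ∃ k : ℕ, g ^ p ^ k ∈ A

lemma mlemma (ρ : Representation ℂ G V) (hρ : IrrRep ρ) (p : ℕ) [hp : Fact p.Prime]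
    (hX : XP p G) : ∃ K : Subgroup G, IsMonomialChar ρ.character ∧
      Module.finrank ℂ V = K.index := by
  obtain ⟨A, hA, hab, hpA⟩ := hX
  have hnt := hρ.1
  obtain ⟨K, -, v, -, h1, h2, h3⟩ := mlemma_aux ρ p A hab hpA _ ⊤ ⊤ rfl
    (fun h => by exact absurd h.symm bot_ne_top) (fun _ _ _ _ => trivial)
    (fun U' _ h => hρ.2 U' fun g => h g trivial)
  rw [Subgroup.relIndex_top_right, finrank_top] at h3
  exact ⟨K, mono_crit ρ hρ K v h1 h2 h3⟩

lemma mGroup_of_XP (p : ℕ) [hp : Fact p.Prime] (hX : XP p G) : IsMGroup G := by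
  intro χ hχ
  obtain ⟨V, _, _, _, ρ, hρ, rfl⟩ := hχ.exists_rep
  obtain ⟨K, h, -⟩ := mlemma ρ hρ p hX
  exact h

end MLemma


section GroupPrelim
variable {G : Type} [Group G]

/-- The inductive hypothesis on a group. -/
def Hyp (p : ℕ) (G : Type) [Group G] : Prop :=
  (∀ l : G →* ℂˣ, ∃ k, l ^ p ^ k = 1) ∧ ∃ x y : ℂ, codSet G ⊆ {1, x, y}

lemma Hyp.surj {p : ℕ} {Q : Type} [Group Q] [Finite G] (h : Hyp p G) (φ : G →* Q)
    (hφ : Function.Surjective φ) : Hyp p Q := by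
  obtain ⟨h1, x, y, h2⟩ := h
  refine ⟨fun l => ?_, x, y, (codSet_surj φ hφ).trans h2⟩
  obtain ⟨k, hk⟩ := h1 (l.comp φ)
  refine ⟨k, ?_⟩
  ext q
  obtain ⟨g, rfl⟩ := hφ q
  have := DFunLike.congr_fun hk g
  simpa using congrArg Units.val this

lemma exists_lin [Finite G] (h : commutator G ≠ ⊤) : ∃ l : G →* ℂˣ, l ≠ 1 := by
  obtain ⟨g, hg⟩ : ∃ g, g ∉ commutator G := by
    by_contra hcon
    push Not at hcon
    exact h (Subgroup.ext fun x => by simp [hcon x])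
  have hne : (Abelianization.of g) ≠ 1 := by
    intro h1
    apply hg
    rw [← Abelianization.ker_of]
    exact h1
  haveI : Finite (Abelianization G) := Quotient.finite _
  haveI : NeZero (Monoid.exponent (Abelianization G)) := ⟨Monoid.exponent_ne_zero_of_finite⟩
  obtain ⟨l, hl⟩ := CommGroup.exists_apply_ne_one_of_hasEnoughRootsOfUnity (Abelianization G) ℂ hne
  refine ⟨l.comp Abelianization.of, fun h2 => hl ?_⟩
  exact DFunLike.congr_fun h2 g

lemma dg_lt_of_codeg [Finite G] {χ : G → ℂ} (hχ : IsIrrChar G χ) (h1 : χ ≠ 1) {n : ℕ}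
    (hn : codeg χ = n) : dg χ < n := by
  have h2 := hχ.codeg_mul
  have h3 := lemmaB hχ h1
  rw [hn] at h2
  have h4 : n * (Nat.card (charKer χ) * dg χ) = Nat.card G := by exact_mod_cast h2
  rw [← h4] at h3
  by_contra hcon
  push Not at hcon
  have : n * (Nat.card (charKer χ) * dg χ) ≤ dg χ * (Nat.card (charKer χ) * dg χ) :=
    Nat.mul_le_mul_right _ hcon
  nlinarith

lemma codeg_ne_one [Finite G] {χ : G → ℂ} (hχ : IsIrrChar G χ) (h1 : χ ≠ 1) : codeg χ ≠ 1 := by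
  intro h
  have := dg_lt_of_codeg hχ h1 (n := 1) (by simpa using h)
  have := hχ.dg_pos
  omega

lemma XP_quot_iff {p : ℕ} (M : Subgroup G) [M.Normal] : XP p (G ⧸ M) ↔
    ∃ A : Subgroup G, A.Normal ∧ (∀ a ∈ A, ∀ b ∈ A, (b * a)⁻¹ * (a * b) ∈ M) ∧
      ∀ g, ∃ k, g ^ p ^ k ∈ A := by
  constructor
  · rintro ⟨A, hA, h1, h2⟩
    refine ⟨A.comap (QuotientGroup.mk' M), hA.comap _, fun a ha b hb => ?_, fun g => ?_⟩
    · have := h1 _ ha _ hb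
      rw [← QuotientGroup.eq]
      exact this.symm
    · obtain ⟨k, hk⟩ := h2 (QuotientGroup.mk' M g)
      exact ⟨k, by rw [Subgroup.mem_comap, map_pow]; exact hk⟩
  · rintro ⟨A, hA, h1, h2⟩
    refine ⟨A.map (QuotientGroup.mk' M), hA.map _ (QuotientGroup.mk'_surjective M), ?_, ?_⟩
    · rintro _ ⟨a, ha, rfl⟩ _ ⟨b, hb, rfl⟩
      exact (QuotientGroup.eq.2 (h1 a ha b hb)).symm
    · intro g
      obtain ⟨g, rfl⟩ := QuotientGroup.mk'_surjective M g
      obtain ⟨k, hk⟩ := h2 g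
      exact ⟨k, g ^ p ^ k, hk, by simp⟩

lemma XP_of_pgroup {p : ℕ} (h : IsPGroup p G) : XP p G :=
  ⟨⊥, inferInstance, by simp +contextual, fun g => by simpa using h g⟩

lemma XP_of_equiv {p : ℕ} {H : Type} [Group H] (e : G ≃* H) (h : XP p G) : XP p H := by
  obtain ⟨A, hA, h1, h2⟩ := h
  refine ⟨A.map e.toMonoidHom, hA.map _ e.surjective, ?_, fun g => ?_⟩
  · rintro _ ⟨a, ha, rfl⟩ _ ⟨b, hb, rfl⟩
    rw [← map_mul, ← map_mul, h1 a ha b hb]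
  · obtain ⟨k, hk⟩ := h2 (e.symm g)
    exact ⟨k, e.symm g ^ p ^ k, hk, by simp⟩

lemma XP.solvable [Finite G] {p : ℕ} [Fact p.Prime] (h : XP p G) : Group.IsSolvable G := by
  obtain ⟨A, hA, h1, h2⟩ := h
  have hp : IsPGroup p (G ⧸ A) := by
    intro g
    obtain ⟨g, rfl⟩ := QuotientGroup.mk'_surjective A g
    obtain ⟨k, hk⟩ := h2 g
    exact ⟨k, by rw [← map_pow]; exact (QuotientGroup.eq_one_iff _).2 hk⟩
  haveI := hp.isNilpotent
  haveI : Group.IsSolvable A := isSolvable_of_comm (fun a b => Subtype.ext (h1 a a.2 b b.2))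
  exact solvable_of_ker_le_range A.subtype (QuotientGroup.mk' A) (by simp)

lemma XP.lin [Finite G] [Nontrivial G] {p : ℕ} [Fact p.Prime] (h : XP p G) :
    ∃ l : G →* ℂˣ, l ≠ 1 := by
  haveI := h.solvable
  exact exists_lin (IsSolvable.commutator_lt_top_of_nontrivial G).ne

/-- unique minimal normal subgroup -/
def UMN (N : Subgroup G) : Prop :=
  N.Normal ∧ N ≠ ⊥ ∧ ∀ M : Subgroup G, M.Normal → M ≠ ⊥ → N ≤ M

lemma exists_UMN [Finite G] [Nontrivial G] {p : ℕ} 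
    (h : ∀ (M : Subgroup G) [M.Normal], M ≠ ⊥ → XP p (G ⧸ M)) (hn : ¬ XP p G) :
    ∃ N : Subgroup G, UMN N := by
  obtain ⟨N, ⟨hN1, hN2⟩, hN3⟩ : ∃ N, Minimal (fun N : Subgroup G => N.Normal ∧ N ≠ ⊥) N :=
    exists_minimal_of_wellFoundedLT _ ⟨⊤, inferInstance, top_ne_bot⟩
  refine ⟨N, hN1, hN2, fun M hM hM1 => ?_⟩
  by_contra hle
  have hbot : N ⊓ M = ⊥ := by
    by_contra h1
    have := hN3 ⟨inferInstance, h1⟩ inf_le_left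
    exact hle (this.trans inf_le_right)
  obtain ⟨A, hA, a1, a2⟩ := (XP_quot_iff N).1 (h N hN2)
  obtain ⟨B, hB, b1, b2⟩ := (XP_quot_iff M).1 (h M hM1)
  refine hn ⟨A ⊓ B, inferInstance, fun a ha b hb => ?_, fun g => ?_⟩
  · have : (b * a)⁻¹ * (a * b) ∈ N ⊓ M :=
      ⟨a1 a ha.1 b hb.1, b1 a ha.2 b hb.2⟩
    rw [hbot, Subgroup.mem_bot] at this
    exact (inv_mul_eq_one.1 this).symm
  · obtain ⟨k, hk⟩ := a2 g
    obtain ⟨j, hj⟩ := b2 g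
    refine ⟨k + j, ?_, ?_⟩
    · rw [pow_add, pow_mul]; exact pow_mem hk _
    · rw [pow_add, mul_comm, pow_mul]; exact pow_mem hj _

end GroupPrelim


section LemF
variable {G : Type} [Group G] [Finite G]

lemma lin_of_dg_one {χ : G → ℂ} (hχ : IsIrrChar G χ) (h1 : dg χ = 1) :
    ∃ l : G →* ℂˣ, χ = fun x => (l x : ℂ) := by
  obtain ⟨V, _, _, _, ρ, hρ, rfl⟩ := hχ.exists_rep
  rw [dg_char] at h1
  obtain ⟨v, hv0, hv⟩ := finrank_eq_one_iff'.1 h1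
  choose c hc using fun g => hv (ρ g v)
  have h2 : ∀ g, ρ g = c g • LinearMap.id := by
    intro g
    ext w
    obtain ⟨d, rfl⟩ := hv w
    rw [map_smul, ← hc g, LinearMap.smul_apply, LinearMap.id_apply, smul_comm]
  have h3 : ∀ g, ρ.character g = c g := by
    intro g
    simp [Representation.character, h2 g, h1]
  have hm : ∀ g h, c (g * h) = c g * c h := by
    intro g h
    have : c (g * h) • v = (c g * c h) • v := by
      rw [hc, map_mul, Module.End.mul_apply, ← hc h, map_smul, ← hc g, smul_smul, mul_comm]
    exact smul_left_injective ℂ hv0 this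
  have h1' : c 1 = 1 := by
    have : c 1 • v = (1 : ℂ) • v := by rw [hc]; simp
    exact smul_left_injective ℂ hv0 this
  let L : G →* ℂ := { toFun := c, map_one' := h1', map_mul' := hm }
  refine ⟨L.toHomUnits, funext fun x => ?_⟩
  rw [h3]; rfl

lemma comm_of_dg_one (h : ∀ χ : G → ℂ, IsIrrChar G χ → dg χ = 1) (a b : G) : a * b = b * a := by
  haveI := Fintype.ofFinite G
  have h1 := reg_sum (a * b * (b * a)⁻¹)
  have h2 : ∀ χ ∈ irrF G, (dg χ : ℂ) * χ (a * b * (b * a)⁻¹) = ((dg χ ^ 2 : ℕ) : ℂ) := by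
    intro χ hχ
    have hχ := mem_irrF.1 hχ
    rw [h χ hχ]
    obtain ⟨l, rfl⟩ := lin_of_dg_one hχ (h χ hχ)
    have : l (a * b * (b * a)⁻¹) = 1 := by
      rw [map_mul, map_inv, map_mul, map_mul, mul_comm (l b), mul_inv_cancel]
    beta_reduce; rw [this]; simp
  rw [Finset.sum_congr rfl h2, ← Nat.cast_sum, sum_sq_all] at h1
  by_contra hne
  rw [if_neg (fun h3 => hne (mul_inv_eq_one.1 h3))] at h1
  have := Nat.card_pos (α := G)
  have h4 : Nat.card G = 0 := by exact_mod_cast h1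
  omega

lemma UMN.ker {N : Subgroup G} (hN : UMN N) {χ : G → ℂ} (hχ : IsIrrChar G χ)
    (h : ¬ (N : Set G) ⊆ charKer χ) : Nat.card (charKer χ) = 1 := by
  obtain ⟨K, hK, hK2⟩ := hχ.isChar.exists_ker
  rw [← hK2] at h ⊢
  by_contra hne
  refine h (hN.2.2 K hK fun hb => hne ?_)
  rw [hb]; simp

lemma UMN.codeg_mul {N : Subgroup G} (hN : UMN N) {χ : G → ℂ} (hχ : IsIrrChar G χ)
    (h : ¬ (N : Set G) ⊆ charKer χ) : codeg χ * dg χ = Nat.card G := by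
  have := hχ.codeg_mul
  rwa [hN.ker hχ h, one_mul] at this

lemma ne_one_of_not_ker {N : Subgroup G} {χ : G → ℂ}
    (h : ¬ (N : Set G) ⊆ charKer χ) : χ ≠ 1 := by
  rintro rfl
  exact h fun x _ => by simp [charKer]

lemma ker_ne_top {χ : G → ℂ} (hχ : IsIrrChar G χ) (h : χ ≠ 1) :
    ¬ ((⊤ : Subgroup G) : Set G) ⊆ charKer χ := by
  intro h1
  have h2 := lemmaB hχ h
  have h3 : charKer χ = Set.univ := Set.eq_univ_of_univ_subset (by simpa using h1)
  rw [h3] at h2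
  have h4 : Nat.card (Set.univ : Set G) = Nat.card G := by simp
  rw [h4] at h2
  have := hχ.dg_pos
  have h5 : 1 ≤ dg χ ^ 2 := Nat.one_le_pow _ _ this
  have := Nat.mul_le_mul_left (Nat.card G) h5
  omega

lemma simple_case (hG : UMN (⊤ : Subgroup G)) {x y : ℂ} (hc : codSet G ⊆ {1, x, y}) (a b : G) :
    a * b = b * a := by
  haveI := Fintype.ofFinite G
  haveI : Nontrivial G := by
    by_contra h
    rw [not_nontrivial_iff_subsingleton] at h
    exact hG.2.1 (Subsingleton.elim _ _)
  by_contra hab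
  have hperf : commutator G = ⊤ := by
    refine top_le_iff.1 (hG.2.2 _ inferInstance fun hb => hab ?_)
    have h2 : commutator G ≤ ⊥ := hb.le
    have h3 : Abelianization.of a * Abelianization.of b = Abelianization.of (b * a) := by
      rw [map_mul, mul_comm]
    rw [← map_mul] at h3
    have h4 : (a * b)⁻¹ * (b * a) ∈ commutator G := by
      rw [← Abelianization.ker_of, MonoidHom.mem_ker, map_mul, map_inv, h3, inv_mul_cancel]
    have h5 := h2 h4
    rw [Subgroup.mem_bot] at h5
    exact inv_mul_eq_one.1 h5
  have hd : ∀ χ : G → ℂ, IsIrrChar G χ → χ ≠ 1 → 1 < dg χ := by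
    intro χ hχ h1
    have h0 := hχ.dg_pos
    by_contra hle
    obtain ⟨l, rfl⟩ := lin_of_dg_one hχ (by omega)
    apply h1
    have h2 : commutator G ≤ l.ker := Abelianization.commutator_subset_ker l
    rw [hperf] at h2
    funext x
    have : l x = 1 := h2 trivial
    rw [this]; simp
  have hm : ∀ χ : G → ℂ, IsIrrChar G χ → χ ≠ 1 → codeg χ * dg χ = Nat.card G :=
    fun χ hχ h1 => hG.codeg_mul hχ (ker_ne_top hχ h1)
  have hxy : ∀ χ : G → ℂ, IsIrrChar G χ → χ ≠ 1 → codeg χ = x ∨ codeg χ = y := by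
    intro χ hχ h1
    have : codeg χ ∈ ({1, x, y} : Set ℂ) := hc ⟨χ, hχ, rfl⟩
    simpa [codeg_ne_one hχ h1] using this
  have hinj : ∀ χ χ' : G → ℂ, IsIrrChar G χ → χ ≠ 1 → IsIrrChar G χ' → χ' ≠ 1 →
      codeg χ = codeg χ' → dg χ = dg χ' := by
    intro χ χ' h1 h2 h3 h4 h5
    have e1 := hm χ h1 h2
    have e2 := hm χ' h3 h4
    rw [h5, ← e2] at e1
    have h0 : codeg χ' ≠ 0 := by
      intro h0
      rw [h0, zero_mul] at e2
      have : Nat.card G = 0 := by exact_mod_cast e2.symm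
      have := Nat.card_pos (α := G)
      omega
    exact_mod_cast mul_left_cancel₀ h0 e1
  obtain ⟨χ0, h0, h01⟩ := exists_irr_ne_one (G := G)
  by_cases hall : ∀ χ : G → ℂ, IsIrrChar G χ → χ ≠ 1 → dg χ = dg χ0
  · exact lemmaSimple (hd χ0 h0 h01) (hd χ0 h0 h01) fun χ h h1 => Or.inl (hall χ h h1)
  · push Not at hall
    obtain ⟨χ1, h1, h11, hne⟩ := hall
    refine lemmaSimple (G := G) (hd χ0 h0 h01) (hd χ1 h1 h11) fun χ h h2 => ?_
    by_contra hcon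
    push Not at hcon
    have n1 : codeg χ1 ≠ codeg χ0 := fun e => hne (hinj _ _ h1 h11 h0 h01 e)
    have n2 : codeg χ ≠ codeg χ0 := fun e => hcon.1 (hinj _ _ h h2 h0 h01 e)
    have n3 : codeg χ ≠ codeg χ1 := fun e => hcon.2 (hinj _ _ h h2 h1 h11 e)
    rcases hxy χ h h2 with e | e <;> rcases hxy χ0 h0 h01 with e' | e' <;>
      rcases hxy χ1 h1 h11 with e'' | e'' <;> rw [e, e'] at n2 <;> rw [e, e''] at n3 <;>
      rw [e', e''] at n1 <;> first | exact n1 rfl | exact n2 rfl | exact n3 rfl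

lemma lemmaS {N : Subgroup G} (hN : UMN N) {p : ℕ} (hp : p.Prime) (hd : p ∣ N.index)
    (hlt : Nat.card G < p ^ 2) : False := by
  haveI := Fact.mk hp
  have h0 := Nat.card_pos (α := G)
  have hdG : p ∣ Nat.card G := hd.trans (Subgroup.index_dvd_card N)
  obtain ⟨P⟩ : Nonempty (Sylow p G) := inferInstance
  have hcard := P.card_eq_multiplicity
  have hf : (Nat.card G).factorization p = 1 := by
    have h1 : 1 ≤ (Nat.card G).factorization p :=
      (hp.dvd_iff_one_le_factorization h0.ne').1 hdG
    by_contra hne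
    have : p ^ 2 ∣ Nat.card G := (hp.pow_dvd_iff_le_factorization h0.ne').2 (by omega)
    exact absurd (Nat.le_of_dvd h0 this) (by omega)
  rw [hf, pow_one] at hcard
  have hidx : (P : Subgroup G).index < p := by
    have := (P : Subgroup G).card_mul_index
    have h2 : Nat.card (P : Subgroup G) = p := hcard
    rw [h2] at this
    have hp0 := hp.pos
    by_contra hcon
    push Not at hcon
    nlinarith
  have hn : Nat.card (Sylow p G) = 1 := by
    have h1 := card_sylow_modEq_one p G
    have h2 : Nat.card (Sylow p G) ≤ (P : Subgroup G).index :=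
      Nat.le_of_dvd (Nat.pos_of_ne_zero Subgroup.index_ne_zero_of_finite) P.card_dvd_index
    have h3 := Nat.mod_eq_of_lt (h2.trans_lt hidx)
    rw [Nat.ModEq, h3, Nat.mod_eq_of_lt hp.one_lt] at h1
    exact h1
  haveI : Subsingleton (Sylow p G) := (Nat.card_eq_one_iff_unique.1 hn).1
  have hPn : (P : Subgroup G).Normal := P.normal_of_subsingleton
  have hPb : (P : Subgroup G) ≠ ⊥ := by
    intro hb
    have h2 : Nat.card (P : Subgroup G) = p := hcard
    rw [hb, Subgroup.card_bot] at h2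
    exact hp.one_lt.ne h2
  have hle := hN.2.2 _ hPn hPb
  have hd2 : Nat.card N ∣ p := by
    have h2 : Nat.card (P : Subgroup G) = p := hcard
    rw [← h2]
    exact Subgroup.card_dvd_of_le hle
  have hNp : Nat.card N = p := by
    rcases (Nat.dvd_prime hp).1 hd2 with h | h
    · exact absurd (Subgroup.card_eq_one.1 h) hN.2.1
    · exact h
  have := N.card_mul_index
  have h3 : p * p ∣ Nat.card G := by
    rw [← this, hNp]; exact mul_dvd_mul_left _ hd
  have := Nat.le_of_dvd h0 h3
  nlinarith

lemma lemmaF {N : Subgroup G} (hN : UMN N) {p : ℕ} (hp : p.Prime) (hd : p ∣ N.index) {b : ℂ}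
    (hc : codSet G ⊆ {1, (p : ℂ), b}) {χ : G → ℂ} (hχ : IsIrrChar G χ)
    (h : ¬ (N : Set G) ⊆ charKer χ) : b * dg χ = Nat.card G := by
  have h1 := ne_one_of_not_ker h
  have h2 := hN.codeg_mul hχ h
  have h3 : codeg χ ∈ ({1, (p : ℂ), b} : Set ℂ) := hc ⟨χ, hχ, rfl⟩
  rcases h3 with h3 | h3 | h3
  · exact absurd h3 (codeg_ne_one hχ h1)
  · have h4 := dg_lt_of_codeg hχ h1 h3
    rw [h3] at h2
    have h5 : p * dg χ = Nat.card G := by exact_mod_cast h2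
    exact (lemmaS hN hp hd (by rw [← h5]; nlinarith [hp.pos])).elim
  · rw [Set.mem_singleton_iff] at h3
    rwa [h3] at h2

lemma lemmaFsum {N : Subgroup G} (hN : UMN N) {p : ℕ} (hp : p.Prime) (hd : p ∣ N.index) {b : ℂ}
    (hc : codSet G ⊆ {1, (p : ℂ), b}) : ∃ f k : ℕ, b * f = Nat.card G ∧ 0 < f ∧
      (∀ χ, IsIrrChar G χ → ¬ (N : Set G) ⊆ charKer χ → dg χ = f) ∧
      k * f ^ 2 = N.index * (Nat.card N - 1) ∧
      ∃ χ, IsIrrChar G χ ∧ ¬ (N : Set G) ⊆ charKer χ := by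
  haveI := Fintype.ofFinite G
  haveI := hN.1
  have hs := sum_sq_F N
  have hN1 : 1 < Nat.card N := by
    have := hN.2.1
    have h0 := Nat.card_pos (α := N)
    have : Nat.card N ≠ 1 := fun h => hN.2.1 (Subgroup.card_eq_one.1 h)
    omega
  have h0 := Nat.card_pos (α := G)
  obtain ⟨χ0, hχ0⟩ : ((irrF G).filter fun χ => ¬ (N : Set G) ⊆ charKer χ).Nonempty := by
    rw [Finset.nonempty_iff_ne_empty]
    intro he
    rw [he, Finset.sum_empty, mul_zero] at hs
    have : 0 < Nat.card G * (Nat.card N - 1) := Nat.mul_pos h0 (by omega)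
    omega
  rw [Finset.mem_filter, mem_irrF] at hχ0
  have hb := lemmaF hN hp hd hc hχ0.1 hχ0.2
  have hb0 : b ≠ 0 := by
    rintro rfl
    rw [zero_mul] at hb
    have : Nat.card G = 0 := by exact_mod_cast hb.symm
    omega
  have heq : ∀ χ, IsIrrChar G χ → ¬ (N : Set G) ⊆ charKer χ → dg χ = dg χ0 := by
    intro χ h1 h2
    have h3 := lemmaF hN hp hd hc h1 h2
    rw [← hb] at h3
    exact_mod_cast mul_left_cancel₀ hb0 h3
  refine ⟨dg χ0, ((irrF G).filter fun χ => ¬ (N : Set G) ⊆ charKer χ).card, hb, hχ0.1.dg_pos,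
    heq, ?_, χ0, hχ0⟩
  rw [Finset.sum_congr rfl (g := fun _ => dg χ0 ^ 2) (fun χ hχ => ?_), Finset.sum_const,
    smul_eq_mul, ← N.card_mul_index, mul_assoc] at hs
  · exact Nat.eq_of_mul_eq_mul_left (by omega) hs
  · rw [Finset.mem_filter, mem_irrF] at hχ
    rw [heq χ hχ.1 hχ.2]

lemma lemmaR {N : Subgroup G} (hN : UMN N) {p : ℕ} (hp : p.Prime) (hd : p ∣ N.index) {b : ℂ}
    (hc : codSet G ⊆ {1, (p : ℂ), b}) {i : ℕ} (hi : N.index = p ^ i) {r : ℕ} (hr : r.Prime)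
    (hrp : r ≠ p) (hrN : r ∣ Nat.card N) (j : ℕ) : b ≠ (p : ℂ) ^ j := by
  intro hb
  obtain ⟨f, k, h1, h2, h3, h4, -⟩ := lemmaFsum hN hp hd hc
  rw [hb] at h1
  have h5 : p ^ j * f = Nat.card G := by exact_mod_cast h1
  have hnp : ∀ i, ¬ r ∣ p ^ i := fun i h =>
    hrp ((Nat.prime_dvd_prime_iff_eq hr hp).1 (hr.dvd_of_dvd_pow h))
  have h6 : r ∣ f := by
    have : r ∣ p ^ j * f := by rw [h5]; exact hrN.trans (Subgroup.card_subgroup_dvd_card N)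
    exact (hr.dvd_mul.1 this).resolve_left (hnp j)
  have h7 : r ∣ N.index * (Nat.card N - 1) := by
    rw [← h4]; exact Dvd.dvd.mul_left (dvd_pow h6 (by norm_num)) _
  rw [hi] at h7
  have h8 := (hr.dvd_mul.1 h7).resolve_left (hnp i)
  have h9 := Nat.dvd_sub hrN h8
  have : Nat.card N - (Nat.card N - 1) = 1 := by
    have := Nat.card_pos (α := N); omega
  rw [this] at h9
  exact hr.one_lt.ne' (Nat.dvd_one.1 h9)

lemma dg_pgroup {p : ℕ} [Fact p.Prime] (hG : IsPGroup p G) {χ : G → ℂ} (hχ : IsIrrChar G χ) :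
    ∃ e, dg χ = p ^ e := by
  obtain ⟨V, _, _, _, ρ, hρ, rfl⟩ := hχ.exists_rep
  obtain ⟨K, -, hK⟩ := mlemma ρ hρ p (XP_of_pgroup hG)
  rw [dg_char, hK]
  obtain ⟨n, hn⟩ := (IsPGroup.iff_card).1 hG
  have : K.index ∣ p ^ n := hn ▸ K.index_dvd_card
  obtain ⟨e, -, he⟩ := (Nat.dvd_prime_pow Fact.out).1 this
  exact ⟨e, he⟩

lemma comm_pgroup {p : ℕ} [hpf : Fact p.Prime] (hG : IsPGroup p G) {b : ℂ}
    (hc : codSet G ⊆ {1, (p : ℂ), b}) (hb : ∀ j : ℕ, b ≠ (p : ℂ) ^ j) (x y : G) :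
    x * y = y * x := by
  haveI := Fintype.ofFinite G
  have hp : p.Prime := Fact.out
  obtain ⟨n, hn⟩ := (IsPGroup.iff_card).1 hG
  refine comm_of_dg_one (fun χ hχ => ?_) x y
  by_cases h1 : χ = 1
  · rw [h1, dg_one]
  obtain ⟨e, he⟩ := dg_pgroup hG hχ
  obtain ⟨a, ha⟩ : ∃ a, Nat.card (charKer χ) = p ^ a := by
    obtain ⟨K, hK, hK2⟩ := hχ.isChar.exists_ker
    have : Nat.card K ∣ p ^ n := hn ▸ Subgroup.card_subgroup_dvd_card K
    obtain ⟨e, -, he⟩ := (Nat.dvd_prime_pow Fact.out).1 this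
    exact ⟨e, by rw [← hK2]; exact he⟩
  have h2 := lemmaB hχ h1
  have h3 := hχ.codeg_mul
  rw [ha, he, hn] at h2 h3
  have hle : a + e ≤ n := by
    have : p ^ (a + e) < p ^ n := by
      refine lt_of_le_of_lt ?_ h2
      rw [pow_add]
      refine Nat.mul_le_mul_left _ ?_
      rw [← pow_mul]
      exact Nat.pow_le_pow_right hp.pos (by omega)
    exact ((Nat.pow_lt_pow_iff_right hp.one_lt).1 this).le
  have hp0 : (p : ℂ) ≠ 0 := by exact_mod_cast hp.ne_zero
  have h4 : codeg χ = (p : ℂ) ^ (n - (a + e)) := by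
    have h5 : (p : ℂ) ^ (a + e) ≠ 0 := pow_ne_zero _ hp0
    apply mul_right_cancel₀ h5
    rw [← pow_add, Nat.sub_add_cancel hle]
    rw [← pow_add] at h3
    exact_mod_cast h3
  have h5 : codeg χ ∈ ({1, (p : ℂ), b} : Set ℂ) := hc ⟨χ, hχ, rfl⟩
  rcases h5 with h5 | h5 | h5
  · exact absurd h5 (codeg_ne_one hχ h1)
  · have h6 := dg_lt_of_codeg hχ h1 h5
    rw [he] at h6 ⊢
    have : e < 1 := (Nat.pow_lt_pow_iff_right hp.one_lt).1 (by simpa using h6)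
    have : e = 0 := by omega
    rw [this, pow_zero]
  · rw [Set.mem_singleton_iff] at h5
    exact absurd (h5.symm.trans h4) (hb _)

/-- Second version of Lemma P. -/
lemma lemmaP {N : Subgroup G} [N.Normal] (hN : UMN N) {p : ℕ} [hpf : Fact p.Prime]
    (hd : p ∣ N.index) {b : ℂ}
    (hc : codSet G ⊆ {1, (p : ℂ), b}) (hQ : IsPGroup p (G ⧸ N)) {r : ℕ} (hr : r.Prime)
    (hrp : r ≠ p) (hrN : r ∣ Nat.card N) (x y : G ⧸ N) : x * y = y * x := by
  obtain ⟨i, hi⟩ := (IsPGroup.iff_card).1 hQ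
  exact comm_pgroup hQ ((codSet_surj (QuotientGroup.mk' N) (QuotientGroup.mk'_surjective N)).trans hc)
    (lemmaR hN Fact.out hd hc (i := i) (by rw [← hi]; rfl) hr hrp hrN) x y

end LemF


section CaseI
variable {G : Type} [Group G] [Finite G]

lemma dg_one_of_ker {N : Subgroup G} [N.Normal] (hN : ∀ x y : G ⧸ N, x * y = y * x)
    {χ : G → ℂ} (hχ : IsIrrChar G χ) (hk : (N : Set G) ⊆ charKer χ) : dg χ = 1 := by
  have h0 := hχ.dg_pos
  obtain ⟨V, _, _, _, ρ, hρ, rfl⟩ := hχ.exists_rep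
  have h1 : ∀ n ∈ N, ρ n = 1 := fun n hn => (charKer_eq ρ n).1 (hk hn)
  have h2 : ∀ x y, ρ x * ρ y = ρ y * ρ x := by
    intro x y
    have : (y * x)⁻¹ * (x * y) ∈ N := by
      rw [← QuotientGroup.eq]
      exact hN (QuotientGroup.mk y) (QuotientGroup.mk x)
    have h3 := h1 _ this
    have h4 : x * y = (y * x) * ((y * x)⁻¹ * (x * y)) := by group
    rw [← map_mul, h4, map_mul, h3, mul_one, map_mul]
  haveI := hρ.1
  have h3 : ∀ g, ∃ c : ℂ, ∀ v, ρ g v = c • v := by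
    intro g
    obtain ⟨c, hc⟩ := Module.End.exists_eigenvalue (ρ g)
    refine ⟨c, fun v => ?_⟩
    rcases hρ.2 (Module.End.eigenspace (ρ g) c) (fun x w hw => by
      rw [Module.End.mem_eigenspace_iff] at hw ⊢
      have := DFunLike.congr_fun (h2 g x) w
      rw [Module.End.mul_apply, Module.End.mul_apply, hw, map_smul] at this
      exact this) with h | h
    · exact absurd h hc
    · have : v ∈ Module.End.eigenspace (ρ g) c := by rw [h]; trivial
      exact Module.End.mem_eigenspace_iff.1 this
  obtain ⟨v, hv⟩ := exists_ne (0 : V)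
  have h4 := finrank_le_index ρ hρ ⊤ v hv fun h _ => by
    obtain ⟨c, hc⟩ := h3 h
    exact ⟨c, hc v⟩
  rw [dg_char] at h0 ⊢
  rw [Subgroup.index_top] at h4
  omega

instance lin_finite : Finite (G →* ℂˣ) := by
  haveI : Finite {χ : G → ℂ | IsIrrChar G χ} := (irr_finite G).to_subtype
  refine Finite.of_injective (fun l : G →* ℂˣ => (⟨fun x => (l x : ℂ), irr_lin l⟩ :
    {χ : G → ℂ | IsIrrChar G χ})) fun l l' h => ?_
  ext x
  have := congrArg Subtype.val h
  exact congrFun this x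

/-- The stabilizer of a character in the group of linear characters with N in the kernel. -/
def linStab (N : Subgroup G) (χ : G → ℂ) : Subgroup (G →* ℂˣ) where
  carrier := {l | (∀ n ∈ N, l n = 1) ∧ ∀ x, (l x : ℂ) * χ x = χ x}
  one_mem' := by simp
  mul_mem' := by
    rintro a b ⟨h1, h2⟩ ⟨h3, h4⟩
    refine ⟨fun n hn => by simp [h1 n hn, h3 n hn], fun x => ?_⟩
    rw [MonoidHom.mul_apply, Units.val_mul, mul_assoc, h4, h2]
  inv_mem' := by
    rintro a ⟨h1, h2⟩
    refine ⟨fun n hn => by simp [h1 n hn], fun x => ?_⟩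
    rw [MonoidHom.inv_apply]
    conv_lhs => rw [← h2 x]
    rw [← mul_assoc, ← Units.val_mul, inv_mul_cancel, Units.val_one, one_mul]

lemma f_dvd {N : Subgroup G} [N.Normal] (hN : ∀ x y : G ⧸ N, x * y = y * x) {f : ℕ}
    (hf : ∀ χ, IsIrrChar G χ → ¬ (N : Set G) ⊆ charKer χ → dg χ = f)
    {χ₀ : G → ℂ} (h0 : IsIrrChar G χ₀) (h0f : dg χ₀ = f) : f ∣ Nat.card (linStab N χ₀) := by
  haveI := Fintype.ofFinite G
  have hc : IsChar G (χ₀ * fun x => χ₀ x⁻¹) := h0.isChar.mul h0.isChar.inv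
  obtain ⟨m, h1, h2⟩ := hc.decomp
  have h3 := deg_sum hc h1
  rw [dg_mul h0.isChar h0.isChar.inv, dg_inv, h0f,
    ← Finset.sum_filter_add_sum_filter_not _ (fun χ => (N : Set G) ⊆ charKer χ)] at h3
  have h4 : f ∣ ∑ χ ∈ irrF G with ¬ (N : Set G) ⊆ charKer χ, m χ * dg χ := by
    refine Finset.dvd_sum fun χ hχ => ?_
    rw [Finset.mem_filter, mem_irrF] at hχ
    rw [hf χ hχ.1 hχ.2]
    exact dvd_mul_left _ _
  have h5 : f ∣ ∑ χ ∈ irrF G with (N : Set G) ⊆ charKer χ, m χ * dg χ := by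
    have : f ∣ f * f := dvd_mul_left _ _
    rw [h3] at this
    exact (Nat.dvd_add_left h4).1 this
  have hm : ∀ l : G →* ℂˣ, m (fun x => (l x : ℂ)) =
      if (∀ x, (l x : ℂ) * χ₀ x = χ₀ x) then 1 else 0 := by
    intro l
    have e1 := h2 _ (irr_lin l)
    have e2 : ip (χ₀ * fun x => χ₀ x⁻¹) (fun x => (l x : ℂ)) = ip χ₀ (fun x => (l x : ℂ) * χ₀ x) := by
      simp only [ip, Pi.mul_apply]
      congr 1
      refine Finset.sum_congr rfl fun x _ => by ring
    rw [e2, ip_orth h0 (h0.lin_mul l)] at e1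
    by_cases hh : ∀ x, (l x : ℂ) * χ₀ x = χ₀ x
    · rw [if_pos hh]
      rw [if_pos (funext fun x => (hh x).symm)] at e1
      exact_mod_cast e1
    · rw [if_neg hh]
      rw [if_neg (fun h => hh fun x => (congrFun h x).symm)] at e1
      exact_mod_cast e1
  convert h5 using 1
  haveI := Fintype.ofFinite (G →* ℂˣ)
  rw [Nat.card_eq_fintype_card, Fintype.card_subtype, Finset.card_eq_sum_ones,
    ← Finset.sum_filter_ne_zero (s := (irrF G).filter _)]
  refine Finset.sum_bij (fun l _ => fun x => (l x : ℂ)) ?_ ?_ ?_ ?_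
  · intro l hl
    have hl : (∀ n ∈ N, l n = 1) ∧ ∀ x, (l x : ℂ) * χ₀ x = χ₀ x := (Finset.mem_filter.1 hl).2
    rw [Finset.mem_filter, Finset.mem_filter, mem_irrF]
    refine ⟨⟨irr_lin l, fun n hn => by simp [charKer, hl.1 n hn]⟩, ?_⟩
    rw [hm, if_pos hl.2, one_mul]
    exact (irr_lin l).dg_pos.ne'
  · intro l _ l' _ h
    ext x
    exact congrFun h x
  · intro χ hχ
    rw [Finset.mem_filter, Finset.mem_filter, mem_irrF] at hχ
    obtain ⟨⟨a1, a2⟩, a3⟩ := hχ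
    obtain ⟨l, rfl⟩ := lin_of_dg_one a1 (dg_one_of_ker hN a1 a2)
    refine ⟨l, Finset.mem_filter.2 ⟨Finset.mem_univ _, ?_, ?_⟩, rfl⟩
    · intro n hn
      have := a2 hn
      simp [charKer] at this
      exact this
    · by_contra hcon
      rw [hm, if_neg hcon, zero_mul] at a3
      exact a3 rfl
  · intro l hl
    have hl : (∀ n ∈ N, l n = 1) ∧ ∀ x, (l x : ℂ) * χ₀ x = χ₀ x := (Finset.mem_filter.1 hl).2
    rw [hm, if_pos hl.2, one_mul, dg_one_of_ker hN (irr_lin l)]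
    exact fun n hn => by simp [charKer, hl.1 n hn]

lemma clifford_dvd {V : Type} [AddCommGroup V] [Module ℂ V] [FiniteDimensional ℂ V]
    (ρ : Representation ℂ G V) (hρ : IrrRep ρ) (N : Subgroup G) [hN : N.Normal]
    (W : Submodule ℂ V) (hW0 : W ≠ ⊥) (hW : ∀ n ∈ N, ∀ w ∈ W, ρ n w ∈ W)
    (hWi : ∀ U ≤ W, (∀ n ∈ N, ∀ w ∈ U, ρ n w ∈ U) → U = ⊥ ∨ U = W) :
    Module.finrank ℂ W ∣ Module.finrank ℂ V := by
  obtain ⟨Y, ⟨hY1, hY2⟩, hY3⟩ : ∃ Y, Maximal (fun Y : Submodule ℂ V =>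
      (∀ n ∈ N, ∀ w ∈ Y, ρ n w ∈ Y) ∧ Module.finrank ℂ W ∣ Module.finrank ℂ Y) Y :=
    exists_maximal_of_wellFoundedGT _ ⟨⊥, by simp, by simp⟩
  suffices h : Y = ⊤ by rwa [h, finrank_top] at hY2
  have key : ∀ g, W.map (ρ g) ≤ Y := by
    intro g
    by_contra hle
    have hgW : ∀ n ∈ N, ∀ w ∈ W.map (ρ g), ρ n w ∈ W.map (ρ g) := by
      rintro n hn _ ⟨w, hw, rfl⟩
      refine ⟨ρ (g⁻¹ * n * g) w, hW _ (by simpa using hN.conj_mem n hn g⁻¹) w hw, ?_⟩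
      rw [← Module.End.mul_apply, ← map_mul, ← Module.End.mul_apply, ← map_mul]
      congr 2
      group
    have hinf : Y ⊓ W.map (ρ g) = ⊥ := by
      set U := (Y ⊓ W.map (ρ g)).map (ρ g⁻¹) with hU
      have hUW : U ≤ W := by
        have := Submodule.map_mono (f := ρ g⁻¹) (inf_le_right : Y ⊓ W.map (ρ g) ≤ _)
        rwa [← map_mul_rep, inv_mul_cancel, map_one_rep] at this
      have hback : U.map (ρ g) = Y ⊓ W.map (ρ g) := by
        rw [hU, ← map_mul_rep, mul_inv_cancel, map_one_rep]
      rcases hWi U hUW (by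
        rintro n hn _ ⟨w, hw, rfl⟩
        refine ⟨ρ (g * n * g⁻¹) w, ⟨hY1 _ (hN.conj_mem n hn g) w hw.1,
          hgW _ (hN.conj_mem n hn g) w hw.2⟩, ?_⟩
        rw [← Module.End.mul_apply, ← map_mul, ← Module.End.mul_apply, ← map_mul]
        congr 2
        group) with h | h
      · rw [← hback, h, Submodule.map_bot]
      · exact absurd (by rw [← h, hback]; exact inf_le_left) hle
    have hd := Submodule.finrank_sup_add_finrank_inf_eq Y (W.map (ρ g))
    rw [hinf, finrank_bot, add_zero, finrank_map_rep] at hd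
    have := hY3 (y := Y ⊔ W.map (ρ g)) ⟨?_, ?_⟩ le_sup_left
    · exact hle (le_sup_right.trans this)
    · intro n hn w hw
      obtain ⟨a, ha, b, hb, rfl⟩ := Submodule.mem_sup.1 hw
      rw [map_add]
      exact Submodule.add_mem_sup (hY1 n hn a ha) (hgW n hn b hb)
    · rw [hd]; exact dvd_add hY2 dvd_rfl
  have hinv : InvSub ρ (⨆ g, W.map (ρ g)) := by
    intro h w hw
    have : (⨆ g, W.map (ρ g)) ≤ (⨆ g, W.map (ρ g)).comap (ρ h) := by
      refine iSup_le fun g => ?_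
      rw [← Submodule.map_le_iff_le_comap, ← map_mul_rep]
      exact le_iSup (fun g => W.map (ρ g)) (h * g)
    exact this hw
  rcases hρ.2 _ hinv with h | h
  · exfalso
    apply hW0
    have := le_iSup (fun g => W.map (ρ g)) 1
    rw [h, map_one_rep] at this
    exact le_bot_iff.1 this
  · rw [← top_le_iff, ← h]
    exact iSup_le key

lemma theta_dvd {N : Subgroup G} [N.Normal] {f : ℕ}
    (hf : ∀ χ, IsIrrChar G χ → ¬ (N : Set G) ⊆ charKer χ → dg χ = f)
    {θ : N → ℂ} (hθ : IsIrrChar N θ) (h1 : θ ≠ 1) : dg θ ∣ f := by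
  haveI := Fintype.ofFinite G
  haveI := Fintype.ofFinite N
  have hexi : ∃ χ ∈ irrF G, ip (fun n : N => χ n) θ ≠ 0 := by
    by_contra hcon
    push Not at hcon
    have e1 : ip (fun n : N => ∑ χ ∈ irrF G, (dg χ : ℂ) * χ n) θ = 0 := by
      have : (fun n : N => ∑ χ ∈ irrF G, (dg χ : ℂ) * χ n) =
          ∑ χ ∈ irrF G, (dg χ : ℂ) • (fun n : N => χ n) := by
        funext n; simp
      rw [this, ip_sum]
      refine Finset.sum_eq_zero fun χ hχ => ?_
      rw [ip_smul, hcon χ hχ, mul_zero]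
    have e2 : (fun n : N => ∑ χ ∈ irrF G, (dg χ : ℂ) * χ n) =
        fun n : N => if n = 1 then (Nat.card G : ℂ) else 0 := by
      funext n
      rw [reg_sum]; simp
    rw [e2, ip] at e1
    simp only [ite_mul, zero_mul, Finset.sum_ite_eq', Finset.mem_univ, if_true, inv_one] at e1
    rw [hθ.isChar.one_eq] at e1
    have := hθ.dg_pos
    have h3 := Nat.card_pos (α := G)
    have h4 := Nat.card_pos (α := N)
    rcases mul_eq_zero.1 e1 with h | h
    · rw [inv_eq_zero] at h
      have : Nat.card N = 0 := by exact_mod_cast h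
      omega
    · have : Nat.card G * dg θ = 0 := by exact_mod_cast h
      rcases mul_eq_zero.1 this with h | h <;> omega
  obtain ⟨χ, hχ, hne⟩ := hexi
  have hχ := mem_irrF.1 hχ
  have hk : ¬ (N : Set G) ⊆ charKer χ := by
    intro hk
    apply hne
    have : (fun n : N => χ n) = (χ 1) • (1 : N → ℂ) := by
      funext n
      have := hk n.2
      simpa [charKer] using this
    rw [this, ip_smul, ip_orth irr_one hθ, if_neg (Ne.symm h1), mul_zero]
  rw [← hf χ hχ hk]
  obtain ⟨V, _, _, _, ρ, hρ, rfl⟩ := hχ.exists_rep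
  obtain ⟨U, _, _, _, σ, hσ, rfl⟩ := hθ.exists_rep
  let ρN : Representation ℂ N V := ρ.comp N.subtype
  have e1 : (fun n : N => ρ.character n) = ρN.character := rfl
  rw [e1, ip_char] at hne
  have hpos : Nontrivial (Representation.IntertwiningMap σ ρN) := by
    by_contra hcon
    rw [not_nontrivial_iff_subsingleton] at hcon
    apply hne
    rw [Module.finrank_zero_of_subsingleton]; simp
  obtain ⟨F, hF⟩ := exists_ne (0 : Representation.IntertwiningMap σ
    ρN)
  have hcomm : ∀ (n : N) (u : U), F.toLinearMap (σ n u) = ρ n (F.toLinearMap u) := by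
    intro n u
    exact DFunLike.congr_fun (F.isIntertwining' n) u
  have hker : LinearMap.ker F.toLinearMap = ⊥ := by
    rcases hσ.2 (LinearMap.ker F.toLinearMap) (fun n w hw => by
      rw [LinearMap.mem_ker] at hw ⊢
      rw [hcomm, hw, map_zero]) with h | h
    · exact h
    · exfalso
      apply hF
      rw [LinearMap.ker_eq_top] at h
      ext u
      exact DFunLike.congr_fun h u
  have hfr := LinearMap.finrank_range_of_inj (LinearMap.ker_eq_bot.1 hker)
  rw [dg_char, dg_char, ← hfr]
  refine clifford_dvd ρ hρ N _ ?_ ?_ ?_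
  · intro hb
    rw [hb, finrank_bot] at hfr
    haveI := hσ.1
    have := Module.finrank_pos (R := ℂ) (M := U)
    omega
  · rintro n hn _ ⟨u, rfl⟩
    exact ⟨σ ⟨n, hn⟩ u, hcomm ⟨n, hn⟩ u⟩
  · intro Y hY hYi
    rcases hσ.2 (Y.comap F.toLinearMap) (fun n w hw => by
      rw [Submodule.mem_comap] at hw ⊢
      rw [hcomm]
      exact hYi n n.2 _ hw) with h | h
    · left
      rw [← Submodule.map_comap_eq_of_le hY, h, Submodule.map_bot]
    · right
      rw [← Submodule.map_comap_eq_of_le hY, h, Submodule.map_top]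

lemma case_i {N : Subgroup G} [N.Normal] (hN : UMN N) {p : ℕ} [hpf : Fact p.Prime]
    (hd : p ∣ N.index) {b : ℂ} (hc : codSet G ⊆ {1, (p : ℂ), b})
    (hlin : ∀ l : G →* ℂˣ, ∃ k, l ^ p ^ k = 1)
    (hQ : IsPGroup p (G ⧸ N)) : XP p G := by
  have hp : p.Prime := Fact.out
  by_cases hNp : IsPGroup p N
  · refine XP_of_pgroup ?_
    obtain ⟨i, hi⟩ := IsPGroup.iff_card.1 hQ
    obtain ⟨j, hj⟩ := IsPGroup.iff_card.1 hNp
    refine IsPGroup.of_card (n := i + j) ?_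
    rw [← N.card_mul_index, Subgroup.index, hi, hj]; ring
  obtain ⟨r, hr, hrp, hrN⟩ : ∃ r : ℕ, r.Prime ∧ r ≠ p ∧ r ∣ Nat.card N := by
    by_contra hcon
    push Not at hcon
    apply hNp
    have h0 := Nat.card_pos (α := N)
    refine IsPGroup.of_card (n := (Nat.card N).primeFactorsList.length) ?_
    refine Nat.eq_prime_pow_of_unique_prime_dvd h0.ne' fun {d} hd hdv => ?_
    by_contra hne
    exact hcon d hd hne hdv
  have hcomm := lemmaP hN hd hc hQ hr hrp hrN
  obtain ⟨i, hi⟩ := IsPGroup.iff_card.1 hQ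
  by_cases hab : ⁅N, N⁆ = ⊥
  · refine ⟨N, inferInstance, fun a ha b hb => ?_, fun g => ?_⟩
    · have := Subgroup.commutator_eq_bot_iff_le_centralizer.1 hab ha
      exact ((Subgroup.mem_centralizer_iff.1 this) b hb).symm
    · obtain ⟨k, hk⟩ := hQ (QuotientGroup.mk' N g)
      rw [← map_pow] at hk
      exact ⟨k, (QuotientGroup.eq_one_iff _).1 hk⟩
  exfalso
  have hle := hN.2.2 ⁅N, N⁆ inferInstance hab
  have hperf : commutator N = ⊤ := by
    rw [eq_top_iff]
    have h1 : (commutator N).map N.subtype = ⁅N, N⁆ := by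
      rw [commutator_def, Subgroup.map_commutator]; simp [← MonoidHom.range_eq_map]
    intro n _
    have := hle n.2
    rw [← h1] at this
    obtain ⟨m, hm, e⟩ := this
    rwa [← Subtype.ext e]
  obtain ⟨f, k, -, hf0, hf, -, χ₀, h0, h0k⟩ := lemmaFsum hN hp hd hc
  have hdv := f_dvd hcomm hf h0 (hf χ₀ h0 h0k)
  have hS : IsPGroup p (linStab N χ₀) := by
    intro l
    obtain ⟨k, hk⟩ := hlin l
    exact ⟨k, Subtype.ext hk⟩
  obtain ⟨a, ha⟩ := IsPGroup.iff_card.1 hS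
  rw [ha] at hdv
  haveI := Fintype.ofFinite N
  haveI : Nontrivial N := (Subgroup.nontrivial_iff_ne_bot N).2 hN.2.1
  refine lemmaT (G := N) p hp fun θ hθ h1 => ?_
  have h2 := (theta_dvd hf hθ h1).trans hdv
  obtain ⟨e, -, he⟩ := (Nat.dvd_prime_pow hp).1 h2
  rcases Nat.eq_zero_or_pos e with h3 | h3
  · exfalso
    rw [h3, pow_zero] at he
    obtain ⟨l, rfl⟩ := lin_of_dg_one hθ he
    apply h1
    have h2 : commutator N ≤ l.ker := Abelianization.commutator_subset_ker l
    rw [hperf] at h2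
    funext x
    have : l x = 1 := h2 trivial
    simp [this]
  · rw [he]; exact dvd_pow_self _ h3.ne'

end CaseI


section Bound

lemma roots_bound {R : Type} [CommRing R] [IsDomain R] [Finite R] {q : ℕ}
    (hfix : ∀ s : R, s ^ q = s) (hq1 : 1 < q) : Nat.card R ≤ q := by
  haveI := Fintype.ofFinite R
  have hdeg : (Polynomial.X ^ q - Polynomial.X : Polynomial R).natDegree = q := by
    rw [Polynomial.natDegree_sub_eq_left_of_natDegree_lt] <;> simp [hq1]
  have hne : (Polynomial.X ^ q - Polynomial.X : Polynomial R) ≠ 0 := by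
    intro h
    rw [h] at hdeg
    simp at hdeg
    omega
  have hroots := Polynomial.card_roots' (Polynomial.X ^ q - Polynomial.X : Polynomial R)
  rw [hdeg] at hroots
  refine le_trans ?_ hroots
  rw [Nat.card_eq_fintype_card, ← Finset.card_univ]
  refine le_trans (Finset.card_le_card ?_) (Multiset.toFinset_card_le _)
  intro s _
  rw [Multiset.mem_toFinset, Polynomial.mem_roots hne]
  simp [hfix s]

lemma ring_bound {Γ W : Type} [Group Γ] [AddCommGroup W] [Finite W] [Nontrivial W]
    (T : Γ →* AddMonoid.End W) (hcomm : ∀ x y, T x * T y = T y * T x) {r n : ℕ} (hr : r.Prime)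
    (hrW : ∀ w : W, r • w = 0)
    (hirr : ∀ S : AddSubgroup W, (∀ x, ∀ s ∈ S, T x s ∈ S) → S = ⊥ ∨ S = ⊤)
    (hq : ∀ x, T x ^ r ^ n = T x) (hn : n ≠ 0) : Nat.card W ≤ r ^ n := by
  let R := Subring.closure (Set.range T)
  letI : CommRing R := Subring.closureCommRingOfComm (by
    rintro _ ⟨x, rfl⟩ _ ⟨y, rfl⟩
    exact hcomm x y)
  haveI : Finite (AddMonoid.End W) := Finite.of_injective (fun f : AddMonoid.End W => (f : W → W))
    DFunLike.coe_injective
  obtain ⟨w0, hw0⟩ := exists_ne (0 : W)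
  have hone : (1 : AddMonoid.End W) ≠ 0 := fun h => hw0 (by
    have := DFunLike.congr_fun h w0
    simpa using this)
  haveI : Nontrivial R := ⟨1, 0, fun h => hone (congrArg Subtype.val h)⟩
  haveI := Fact.mk hr
  haveI : CharP R r := by
    refine (CharP.charP_iff_prime_eq_zero hr).2 ?_
    have h1 : ((r : R) : AddMonoid.End W) = (r : AddMonoid.End W) := rfl
    apply Subtype.ext
    rw [h1]
    ext w
    exact (AddMonoid.End.natCast_apply r w).trans (hrW w)
  have hcommR : ∀ (s : R) x, T x * (s : AddMonoid.End W) = s * T x := by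
    intro s x
    have := mul_comm (⟨T x, Subring.subset_closure ⟨x, rfl⟩⟩ : R) s
    exact congrArg Subtype.val this
  have hfix : ∀ s : R, s ^ r ^ n = s := by
    have h1 : ∀ s (hs : s ∈ Subring.closure (Set.range T)), (⟨s, hs⟩ : R) ^ r ^ n = ⟨s, hs⟩ := by
      intro s hs
      rw [← iterateFrobenius_def]
      induction hs using Subring.closure_induction with
      | mem x h =>
        obtain ⟨x, rfl⟩ := h
        rw [iterateFrobenius_def]
        exact Subtype.ext (hq x)
      | zero => exact map_zero (iterateFrobenius R r n)
      | one => exact map_one (iterateFrobenius R r n)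
      | add x y hx hy h1 h2 =>
        have := map_add (iterateFrobenius R r n) ⟨x, hx⟩ ⟨y, hy⟩
        rw [h1, h2] at this
        exact this
      | neg x hx h1 =>
        have := map_neg (iterateFrobenius R r n) ⟨x, hx⟩
        rw [h1] at this
        exact this
      | mul x y hx hy h1 h2 =>
        have := map_mul (iterateFrobenius R r n) ⟨x, hx⟩ ⟨y, hy⟩
        rw [h1, h2] at this
        exact this
    exact fun s => h1 s s.2
  have hker : ∀ s : R, s ≠ 0 → ∀ w, (s : AddMonoid.End W) w = 0 → w = 0 := by
    intro s hs w hw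
    rcases hirr (AddMonoidHom.ker (s : AddMonoid.End W)) (fun x v hv => by
      change (s : AddMonoid.End W) v = 0 at hv
      change (s : AddMonoid.End W) (T x v) = 0
      have := DFunLike.congr_fun (hcommR s x) v
      change T x ((s : AddMonoid.End W) v) = (s : AddMonoid.End W) (T x v) at this
      rw [← this, hv, map_zero]) with h | h
    · have : w ∈ AddMonoidHom.ker (s : AddMonoid.End W) := hw
      rw [h] at this
      exact this
    · exfalso
      apply hs
      apply Subtype.ext
      ext v
      have : v ∈ AddMonoidHom.ker (s : AddMonoid.End W) := by rw [h]; trivial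
      exact this
  haveI : NoZeroDivisors R := ⟨by
    intro a b hab
    by_contra hcon
    push Not at hcon
    have h1 := congrArg Subtype.val hab
    have h2 := DFunLike.congr_fun h1 w0
    change (a : AddMonoid.End W) ((b : AddMonoid.End W) w0) = 0 at h2
    exact hw0 (hker b hcon.2 _ (hker a hcon.1 _ h2))⟩
  haveI : IsDomain R := NoZeroDivisors.to_isDomain R
  have hsurj : Function.Surjective (fun s : R => (s : AddMonoid.End W) w0) := by
    let ev : R →+ W := { toFun := fun s => (s : AddMonoid.End W) w0, map_zero' := rfl,
                         map_add' := fun a b => rfl }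
    rcases hirr ev.range (by
      rintro x _ ⟨s, rfl⟩
      exact ⟨⟨T x, Subring.subset_closure ⟨x, rfl⟩⟩ * s, rfl⟩) with h | h
    · exfalso
      have : w0 ∈ ev.range := ⟨1, rfl⟩
      rw [h] at this
      exact hw0 this
    · intro w
      have : w ∈ ev.range := by rw [h]; trivial
      exact this
  refine (Nat.card_le_card_of_surjective _ hsurj).trans ?_
  exact roots_bound hfix (Nat.one_lt_pow hn hr.one_lt)

end Bound


section GroupBound
variable {Γ : Type} [Group Γ] [Finite Γ]

lemma eq_one_of_coprime {H : Type} [Group H] {a b : ℕ} (h : Nat.Coprime a b) {x : H}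
    (h1 : x ^ a = 1) (h2 : x ^ b = 1) : x = 1 := by
  have := Nat.dvd_gcd (orderOf_dvd_of_pow_eq_one h1) (orderOf_dvd_of_pow_eq_one h2)
  rw [h, Nat.dvd_one] at this
  exact orderOf_eq_one_iff.1 this

lemma group_bound {V : Subgroup Γ} [hVn : V.Normal] (hV : UMN V)
    (hab : ∀ a ∈ V, ∀ b ∈ V, a * b = b * a) {r n : ℕ} (hr : r.Prime)
    (hrV : ∀ v ∈ V, v ^ r = 1) (hcomm : ∀ x y : Γ ⧸ V, x * y = y * x)
    (hq : ∀ x : Γ, x⁻¹ * x ^ r ^ n ∈ V) (hn : n ≠ 0) : Nat.card V ≤ r ^ n := by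
  letI : CommGroup V := { (inferInstance : Group V) with
    mul_comm := fun a b => Subtype.ext (hab a a.2 b b.2) }
  haveI : Nontrivial V := (Subgroup.nontrivial_iff_ne_bot V).2 hV.2.1
  let T : Γ →* AddMonoid.End (Additive V) :=
    { toFun := fun x => MonoidHom.toAdditive (MulAut.conjNormal x : MulAut V).toMonoidHom
      map_one' := by
        refine DFunLike.ext _ _ fun v => ?_
        apply Additive.toMul.injective
        apply Subtype.ext
        change 1 * (v.toMul : Γ) * 1⁻¹ = (v.toMul : Γ)
        simp
      map_mul' := by
        intro x y
        refine DFunLike.ext _ _ fun v => ?_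
        apply Additive.toMul.injective
        apply Subtype.ext
        change (x * y) * (v.toMul : Γ) * (x * y)⁻¹ = x * (y * (v.toMul : Γ) * y⁻¹) * x⁻¹
        group }
  have hT1 : ∀ v ∈ V, T v = 1 := by
    intro v hv
    refine DFunLike.ext _ _ fun w => ?_
    apply Additive.toMul.injective
    apply Subtype.ext
    change v * (w.toMul : Γ) * v⁻¹ = (w.toMul : Γ)
    rw [hab v hv _ w.toMul.2, mul_inv_cancel_right]
  have hTeq : ∀ x y, x⁻¹ * y ∈ V → T y = T x := by
    intro x y h
    have : y = x * (x⁻¹ * y) := by group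
    rw [this, map_mul, hT1 _ h, mul_one]
  have := ring_bound (W := Additive V) T ?_ hr (n := n) ?_ ?_ ?_ hn
  · exact this
  · intro x y
    rw [← map_mul, ← map_mul]
    refine hTeq _ _ ?_
    rw [← QuotientGroup.eq]
    exact hcomm (QuotientGroup.mk y) (QuotientGroup.mk x)
  · intro w
    apply Additive.toMul.injective
    apply Subtype.ext
    exact hrV _ w.toMul.2
  · intro S hS
    let L : Subgroup Γ :=
      { carrier := {g | ∃ h : g ∈ V, Additive.ofMul (⟨g, h⟩ : V) ∈ S}
        one_mem' := ⟨V.one_mem, S.zero_mem⟩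
        mul_mem' := by
          rintro a b ⟨h1, h2⟩ ⟨h3, h4⟩
          exact ⟨V.mul_mem h1 h3, S.add_mem h2 h4⟩
        inv_mem' := by
          rintro a ⟨h1, h2⟩
          exact ⟨V.inv_mem h1, S.neg_mem h2⟩ }
    have hLn : L.Normal := ⟨by
      rintro g ⟨h1, h2⟩ x
      exact ⟨hVn.conj_mem g h1 x, hS x _ h2⟩⟩
    by_cases hL : L = ⊥
    · left
      rw [eq_bot_iff]
      intro s hs
      have : (s.toMul : Γ) ∈ L := ⟨s.toMul.2, hs⟩
      rw [hL, Subgroup.mem_bot] at this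
      apply Additive.toMul.injective
      apply Subtype.ext
      exact this
    · right
      rw [eq_top_iff]
      intro s _
      obtain ⟨h1, h2⟩ := hV.2.2 L hLn hL s.toMul.2
      exact h2
  · intro x
    rw [← map_pow]
    exact hTeq _ _ (hq x)

/-- stabilizers of nontrivial linear characters of V lie in V -/
lemma stab_le {V : Subgroup Γ} [hVn : V.Normal] (hV : UMN V)
    (hab : ∀ a ∈ V, ∀ b ∈ V, a * b = b * a) {p r m : ℕ} (hp : p.Prime) (hr : r.Prime)
    (hrp : r ≠ p) (hcV : Nat.card V = r ^ m)
    (hcomm : ∀ x y : Γ ⧸ V, x * y = y * x) (hpV : ∀ x : Γ, ∃ k, x ^ p ^ k ∈ V)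
    (lam : V → ℂ) (hmul : ∀ a b, lam (a * b) = lam a * lam b) (h0 : ∀ a, lam a ≠ 0)
    (hne : ∃ v, lam v ≠ 1)
    (x : Γ) (hx : ∀ v w : V, (w : Γ) = x⁻¹ * v * x → lam w = lam v) : x ∈ V := by
  have hone : lam 1 = 1 := by
    have := hmul 1 1
    rw [one_mul] at this
    have h2 := h0 1
    field_simp at this
    exact this.symm
  have hcoprime : ∀ k, Nat.Coprime (p ^ k) (Nat.card V) := by
    intro k
    rw [hcV]
    exact Nat.Coprime.pow _ _ ((Nat.coprime_primes hp hr).2 hrp.symm)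
  have hexp : ∀ v ∈ V, v ^ Nat.card V = 1 := by
    intro v hv
    have := pow_card_eq_one' (x := (⟨v, hv⟩ : V))
    exact congrArg Subtype.val this
  -- commutators
  let K : Subgroup Γ :=
    { carrier := {g | ∃ v ∈ V, g = x⁻¹ * v * x * v⁻¹}
      one_mem' := ⟨1, V.one_mem, by group⟩
      mul_mem' := by
        rintro _ _ ⟨v, hv, rfl⟩ ⟨w, hw, rfl⟩
        refine ⟨v * w, V.mul_mem hv hw, ?_⟩
        have h1 : x⁻¹ * w * x * w⁻¹ ∈ V :=
          V.mul_mem (by simpa using hVn.conj_mem w hw x⁻¹) (V.inv_mem hw)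
        have h2 := hab _ (V.inv_mem hv) _ h1
        calc x⁻¹ * v * x * v⁻¹ * (x⁻¹ * w * x * w⁻¹)
            = x⁻¹ * v * x * (v⁻¹ * (x⁻¹ * w * x * w⁻¹)) := by group
          _ = x⁻¹ * v * x * ((x⁻¹ * w * x * w⁻¹) * v⁻¹) := by rw [h2]
          _ = _ := by group
      inv_mem' := by
        rintro _ ⟨v, hv, rfl⟩
        refine ⟨v⁻¹, V.inv_mem hv, ?_⟩
        have h1 : x⁻¹ * v⁻¹ * x ∈ V := by simpa using hVn.conj_mem _ (V.inv_mem hv) x⁻¹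
        have h2 := hab _ hv _ h1
        calc (x⁻¹ * v * x * v⁻¹)⁻¹ = v * (x⁻¹ * v⁻¹ * x) := by group
          _ = (x⁻¹ * v⁻¹ * x) * v := h2
          _ = _ := by group }
  have hconj : ∀ g : Γ, ∃ u ∈ V, g * x * g⁻¹ = x * u := by
    intro g
    refine ⟨x⁻¹ * (g * x * g⁻¹), ?_, by group⟩
    have : (x * g)⁻¹ * (g * x) ∈ V := by
      rw [← QuotientGroup.eq]
      exact hcomm (QuotientGroup.mk x) (QuotientGroup.mk g)
    have h2 := hVn.conj_mem _ this g
    have h3 : g * ((x * g)⁻¹ * (g * x)) * g⁻¹ = x⁻¹ * (g * x * g⁻¹) := by group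
    rwa [h3] at h2
  have hKn : K.Normal := ⟨by
    rintro _ ⟨v, hv, rfl⟩ g
    obtain ⟨u, hu, hgu⟩ := hconj g
    have hv' := hVn.conj_mem v hv g
    refine ⟨g * v * g⁻¹, hv', ?_⟩
    set w := g * v * g⁻¹ with hw
    have hxw : x⁻¹ * w * x ∈ V := by simpa using hVn.conj_mem w hv' x⁻¹
    calc g * (x⁻¹ * v * x * v⁻¹) * g⁻¹
        = (g * x * g⁻¹)⁻¹ * w * (g * x * g⁻¹) * w⁻¹ := by rw [hw]; group
      _ = u⁻¹ * ((x⁻¹ * w * x) * u) * w⁻¹ := by rw [hgu]; group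
      _ = u⁻¹ * (u * (x⁻¹ * w * x)) * w⁻¹ := by rw [hab _ hxw _ hu]
      _ = _ := by group⟩
  have hKb : K = ⊥ := by
    by_contra hK
    obtain ⟨v, hv⟩ := hne
    obtain ⟨w, hw, e⟩ := hV.2.2 K hKn hK v.2
    have hxw : x⁻¹ * w * x ∈ V := by simpa using hVn.conj_mem w hw x⁻¹
    have h1 := hx ⟨w, hw⟩ ⟨_, hxw⟩ rfl
    have h2 : (⟨_, hxw⟩ : V) = v * ⟨w, hw⟩ := by
      apply Subtype.ext
      change x⁻¹ * w * x = v * w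
      rw [e]; group
    rw [h2, hmul] at h1
    apply hv
    exact mul_right_cancel₀ (h0 _) (by rw [h1, one_mul])
  have hcen : ∀ v ∈ V, v * x = x * v := by
    intro v hv
    have : x⁻¹ * v * x * v⁻¹ ∈ K := ⟨v, hv, rfl⟩
    rw [hKb, Subgroup.mem_bot, mul_inv_eq_one] at this
    calc v * x = x * (x⁻¹ * v * x) := by group
      _ = x * v := by rw [this]
  by_contra hxV
  set y := x ^ Nat.card V with hy
  have hycen : ∀ g : Γ, g * y * g⁻¹ = y := by
    intro g
    obtain ⟨u, hu, hgu⟩ := hconj g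
    have hc : Commute x u := (hcen u hu).symm
    rw [hy, ← conj_pow, hgu, hc.mul_pow, hexp u hu, mul_one]
  obtain ⟨k, hk⟩ := hpV x
  have hyk : y ^ p ^ k = 1 := by
    rw [hy, ← pow_mul, mul_comm, pow_mul, hexp _ hk]
  have hy1 : y ≠ 1 := by
    intro hy1
    apply hxV
    have e1 : (QuotientGroup.mk' V x) ^ p ^ k = 1 := by
      rw [← map_pow]; exact (QuotientGroup.eq_one_iff _).2 hk
    have e2 : (QuotientGroup.mk' V x) ^ Nat.card V = 1 := by
      rw [← map_pow, ← hy, hy1, map_one]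
    exact (QuotientGroup.eq_one_iff _).1 (eq_one_of_coprime (hcoprime k) e1 e2)
  have hZn : (Subgroup.zpowers y).Normal := ⟨by
    rintro _ ⟨i, rfl⟩ g
    refine ⟨i, ?_⟩
    simp only
    rw [← conj_zpow, hycen]⟩
  have hZ := hV.2.2 _ hZn (by simpa using hy1)
  apply hV.2.1
  rw [eq_bot_iff]
  intro v hv
  obtain ⟨i, hi⟩ := hZ hv
  simp only at hi
  have e1 : v ^ p ^ k = 1 := by
    rw [← hi, ← zpow_natCast, ← zpow_mul, mul_comm, zpow_mul, zpow_natCast, hyk, one_zpow]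
  have e2 := hexp v hv
  exact eq_one_of_coprime (hcoprime k) e1 e2

end GroupBound


section CaseII

lemma deg_eq_index {Γ : Type} [Group Γ] [Finite Γ] {V : Subgroup Γ} [hVn : V.Normal] (hV : UMN V)
    (hab : ∀ a ∈ V, ∀ b ∈ V, a * b = b * a) {p r m : ℕ} (hp : p.Prime) (hr : r.Prime)
    (hrp : r ≠ p) (hcV : Nat.card V = r ^ m)
    (hcomm : ∀ x y : Γ ⧸ V, x * y = y * x) (hpV : ∀ x : Γ, ∃ k, x ^ p ^ k ∈ V)
    {χ : Γ → ℂ} (hχ : IsIrrChar Γ χ) (hk : ¬ (V : Set Γ) ⊆ charKer χ) : dg χ = V.index := by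
  obtain ⟨U, _, _, _, ρ, hρ, rfl⟩ := hχ.exists_rep
  rw [dg_char]
  haveI := hρ.1
  obtain ⟨lam, hlam⟩ := exists_wt ρ (V : Set Γ) hab ⊤ (by simp) top_ne_bot
  rw [top_inf_eq] at hlam
  obtain ⟨u, hu, hu0⟩ := Submodule.exists_mem_ne_zero_of_ne_bot hlam
  rw [mem_wt] at hu
  have hmul : ∀ a b : V, lam (a * b) = lam a * lam b := by
    intro a b
    have h1 := hu (a * b)
    have h2 : ρ ((a * b : V) : Γ) u = (lam a * lam b) • u := by
      rw [Subgroup.coe_mul, map_mul, Module.End.mul_apply, hu b, map_smul, hu a, smul_smul, mul_comm]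
    exact smul_left_injective ℂ hu0 (h1.symm.trans h2)
  have hone : lam (1 : V) = 1 := by
    have h1 := hu (1 : V)
    have h2 : ρ ((1 : V) : Γ) u = (1 : ℂ) • u := by simp
    exact smul_left_injective ℂ hu0 (h1.symm.trans h2)
  have h0 : ∀ a : V, lam a ≠ 0 := by
    intro a h
    have := hmul a a⁻¹
    rw [mul_inv_cancel, hone, h, zero_mul] at this
    exact one_ne_zero this
  have hgen : ∀ (l : V → ℂ) (w : U), (∀ v : V, ρ v w = l v • w) → ∀ (g : Γ) (v : V),
      ρ v (ρ g w) = l ⟨g⁻¹ * v * g, by simpa using hVn.conj_mem v v.2 g⁻¹⟩ • ρ g w := by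
    intro l w hw g v
    rw [← map_smul, ← hw, ← Module.End.mul_apply, ← Module.End.mul_apply, ← map_mul, ← map_mul]
    congr 2
    simp only
    group
  have hne : ∃ v : V, lam v ≠ 1 := by
    by_contra hcon
    push Not at hcon
    apply hk
    let F : Submodule ℂ U := wt ρ (V : Set Γ) (fun _ => 1)
    have hF : InvSub ρ F := by
      intro g w hw
      rw [mem_wt] at hw ⊢
      exact fun v => hgen (fun _ => 1) w hw g v
    rcases hρ.2 F hF with h | h
    · exfalso
      have : u ∈ F := (mem_wt ρ _ _ _).2 fun v => by rw [hu v, hcon v]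
      rw [h] at this
      exact hu0 this
    · intro v hv
      change ρ.character v = ρ.character 1
      rw [charKer_eq]
      ext w
      have : w ∈ F := by rw [h]; trivial
      have := (mem_wt ρ _ _ _).1 this ⟨v, hv⟩
      simpa using this
  apply le_antisymm
  · exact finrank_le_index ρ hρ V u hu0 fun h hh => ⟨lam ⟨h, hh⟩, hu ⟨h, hh⟩⟩
  · let gl : Γ → V → ℂ := fun g v =>
      lam (⟨g⁻¹ * v * g, by simpa using hVn.conj_mem v v.2 g⁻¹⟩ : V)
    have hinj : Function.Injective (fun q : Γ ⧸ V => gl q.out) := by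
      intro a b h
      have h' : ∀ v, gl a.out v = gl b.out v := fun v => congrFun h v
      have : a.out⁻¹ * b.out ∈ V := by
        refine stab_le hV hab hp hr hrp hcV hcomm hpV lam hmul h0 hne _ ?_
        intro v w hw
        have h2 := h' ⟨a.out * v * a.out⁻¹, hVn.conj_mem v v.2 _⟩
        have e1 : gl a.out ⟨a.out * v * a.out⁻¹, hVn.conj_mem v v.2 _⟩ = lam v := by
          simp only [gl]
          congr 1
          apply Subtype.ext
          simp only
          group
        have e2 : gl b.out ⟨a.out * v * a.out⁻¹, hVn.conj_mem v v.2 _⟩ = lam w := by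
          simp only [gl]
          congr 1
          apply Subtype.ext
          simp only [hw]
          group
        rw [← e1, ← e2, h2]
      have h3 := QuotientGroup.eq.2 this
      rwa [QuotientGroup.out_eq', QuotientGroup.out_eq'] at h3
    have hind := (wt_indep ρ (V : Set Γ) hab).comp hinj
    haveI := Fintype.ofFinite (Γ ⧸ V)
    have h1 := sum_finrank_le _ hind ⊤ (fun _ => le_top)
    rw [finrank_top] at h1
    refine le_trans ?_ h1
    rw [Subgroup.index, Nat.card_eq_fintype_card, ← Finset.card_univ, Finset.card_eq_sum_ones]
    refine Finset.sum_le_sum fun q _ => ?_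
    rw [Nat.one_le_iff_ne_zero, Function.comp_apply]
    intro h
    rw [Submodule.finrank_eq_zero] at h
    have hm : ρ q.out u ∈ wt ρ (V : Set Γ) (gl q.out) :=
      (mem_wt ρ _ _ _).2 fun v => hgen lam u hu q.out v
    rw [h, Submodule.mem_bot] at hm
    apply hu0
    have := congrArg (ρ q.out⁻¹) hm
    rwa [map_zero, ← Module.End.mul_apply, ← map_mul, inv_mul_cancel, map_one] at this

lemma gamma_struct {Γ : Type} [Group Γ] [Finite Γ] {p : ℕ} [hpf : Fact p.Prime] (hX : XP p Γ)
    (hnp : ¬ IsPGroup p Γ)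
    (hq : ∀ L : Subgroup Γ, L.Normal → L ≠ ⊥ → ∀ g : Γ, ∃ k, g ^ p ^ k ∈ L)
    (hlin : ∀ l : Γ →* ℂˣ, ∃ k, l ^ p ^ k = 1) {b : ℂ} (hc : codSet Γ ⊆ {1, (p : ℂ), b}) :
    ∃ (V : Subgroup Γ) (_ : V.Normal) (r m i : ℕ), UMN V ∧ (∀ a ∈ V, ∀ b ∈ V, a * b = b * a) ∧
      r.Prime ∧ r ≠ p ∧ (∀ v ∈ V, v ^ r = 1) ∧ (∀ x y : Γ ⧸ V, x * y = y * x) ∧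
      Nat.card V = r ^ m ∧ V.index = p ^ i ∧ b = Nat.card V := by
  have hp : p.Prime := Fact.out
  haveI : Nontrivial Γ := by
    by_contra h
    rw [not_nontrivial_iff_subsingleton] at h
    exact hnp fun g => ⟨0, Subsingleton.elim _ _⟩
  obtain ⟨V, ⟨hN1, hN2⟩, hN3⟩ : ∃ N, Minimal (fun N : Subgroup Γ => N.Normal ∧ N ≠ ⊥) N :=
    exists_minimal_of_wellFoundedLT _ ⟨⊤, inferInstance, top_ne_bot⟩
  have hpow : ∀ (g : Γ) {k j : ℕ} {A : Subgroup Γ}, g ^ p ^ k ∈ A → g ^ p ^ (k + j) ∈ A := by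
    intro g k j A h
    rw [pow_add, pow_mul]; exact pow_mem h _
  have hV : UMN V := by
    refine ⟨hN1, hN2, fun M hM hM1 => ?_⟩
    by_contra hle
    have hbot : V ⊓ M = ⊥ := by
      by_contra h1
      have := hN3 ⟨inferInstance, h1⟩ inf_le_left
      exact hle (this.trans inf_le_right)
    apply hnp
    intro g
    obtain ⟨k, hk⟩ := hq V hN1 hN2 g
    obtain ⟨j, hj⟩ := hq M hM hM1 g
    have : g ^ p ^ (k + j) ∈ V ⊓ M := ⟨hpow g hk, by rw [add_comm]; exact hpow g hj⟩
    rw [hbot] at this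
    exact ⟨_, this⟩
  have hpV : ∀ g : Γ, ∃ k, g ^ p ^ k ∈ V := hq V hN1 hN2
  have hab : ∀ a ∈ V, ∀ b ∈ V, a * b = b * a := by
    obtain ⟨A, hA, h1, h2⟩ := hX
    have hAb : A ≠ ⊥ := by
      rintro rfl
      exact hnp h2
    have hle := hV.2.2 A hA hAb
    exact fun a ha b hb => h1 a (hle ha) b (hle hb)
  have hQ : IsPGroup p (Γ ⧸ V) := by
    intro g
    obtain ⟨g, rfl⟩ := QuotientGroup.mk'_surjective V g
    obtain ⟨k, hk⟩ := hpV g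
    exact ⟨k, by rw [← map_pow]; exact (QuotientGroup.eq_one_iff _).2 hk⟩
  obtain ⟨i, hi⟩ := IsPGroup.iff_card.1 hQ
  have hVp : ¬ IsPGroup p V := by
    intro h
    apply hnp
    obtain ⟨j, hj⟩ := IsPGroup.iff_card.1 h
    refine IsPGroup.of_card (n := i + j) ?_
    rw [← V.card_mul_index, Subgroup.index, hi, hj]; ring
  obtain ⟨r, hr, hrp, hrN⟩ : ∃ r : ℕ, r.Prime ∧ r ≠ p ∧ r ∣ Nat.card V := by
    by_contra hcon
    push Not at hcon
    apply hVp
    have h0 := Nat.card_pos (α := V)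
    refine IsPGroup.of_card (n := (Nat.card V).primeFactorsList.length) ?_
    refine Nat.eq_prime_pow_of_unique_prime_dvd h0.ne' fun {d} hd hdv => ?_
    by_contra hne
    exact hcon d hd hne hdv
  haveI := Fact.mk hr
  have hrV : ∀ v ∈ V, v ^ r = 1 := by
    let L : Subgroup Γ :=
      { carrier := {v | v ∈ V ∧ v ^ r = 1}
        one_mem' := ⟨V.one_mem, one_pow _⟩
        mul_mem' := by
          rintro a b ⟨h1, h2⟩ ⟨h3, h4⟩
          refine ⟨V.mul_mem h1 h3, ?_⟩
          have : Commute a b := hab a h1 b h3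
          rw [this.mul_pow, h2, h4, one_mul]
        inv_mem' := by
          rintro a ⟨h1, h2⟩
          exact ⟨V.inv_mem h1, by rw [inv_pow, h2, inv_one]⟩ }
    have hL : L.Normal := ⟨by
      rintro v ⟨h1, h2⟩ g
      exact ⟨hN1.conj_mem v h1 g, by rw [conj_pow, h2]; group⟩⟩
    have hLb : L ≠ ⊥ := by
      obtain ⟨v, hv⟩ := exists_prime_orderOf_dvd_card' (G := V) r hrN
      intro h
      have : (v : Γ) ∈ L := ⟨v.2, by
        have := pow_orderOf_eq_one v
        rw [hv] at this
        exact congrArg Subtype.val this⟩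
      rw [h, Subgroup.mem_bot] at this
      have h1 : v = 1 := Subtype.ext this
      rw [h1, orderOf_one] at hv
      exact hr.one_lt.ne hv
    exact fun v hv => (hV.2.2 L hL hLb hv).2
  have hVr : IsPGroup r V := fun v => ⟨1, by rw [pow_one]; exact Subtype.ext (hrV v v.2)⟩
  obtain ⟨m, hm⟩ := IsPGroup.iff_card.1 hVr
  have hi' : V.index = p ^ i := hi
  have hd : p ∣ V.index := by
    rw [hi']
    refine dvd_pow_self _ ?_
    rintro rfl
    rw [pow_zero, Subgroup.index_eq_one] at hi'
    have hcm : commutator Γ ≠ ⊤ := by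
      intro h
      have h2 : commutator Γ = ⊥ := by
        rw [commutator_def, Subgroup.commutator_eq_bot_iff_le_centralizer]
        intro x _
        rw [Subgroup.mem_centralizer_iff]
        intro y _
        exact hab y (by rw [hi']; trivial) x (by rw [hi']; trivial)
      rw [h2] at h
      exact bot_ne_top h
    obtain ⟨l, hl⟩ := exists_lin hcm
    obtain ⟨k, hk⟩ := hlin l
    apply hl
    refine MonoidHom.ext fun x => ?_
    rw [MonoidHom.one_apply]
    refine eq_one_of_coprime (H := ℂˣ) (a := p ^ k) (b := r) ?_ ?_ ?_
    · exact Nat.Coprime.pow_left _ ((Nat.coprime_primes hp hr).2 hrp.symm)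
    · have := DFunLike.congr_fun hk x
      simpa using this
    · rw [← map_pow, hrV x (by rw [hi']; trivial), map_one]
  have hcomm := lemmaP hV hd hc hQ hr hrp hrN
  obtain ⟨f, k, hb, hf0, hf, -, χ₀, h0, h0k⟩ := lemmaFsum hV hp hd hc
  refine ⟨V, hN1, r, m, i, hV, hab, hr, hrp, hrV, hcomm, hm, hi', ?_⟩
  have e1 := deg_eq_index hV hab hp hr hrp hm hcomm hpV h0 h0k
  rw [hf χ₀ h0 h0k] at e1
  have hf' : (f : ℂ) ≠ 0 := by exact_mod_cast hf0.ne'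
  apply mul_right_cancel₀ hf'
  rw [hb, e1, ← V.card_mul_index]
  push_cast
  ring

lemma case_ii {G : Type} [Group G] [Finite G] {N : Subgroup G} [hNn : N.Normal] (hN : UMN N)
    {p : ℕ} [hpf : Fact p.Prime]
    (hd : p ∣ N.index) {b : ℂ} (hc : codSet G ⊆ {1, (p : ℂ), b})
    (hlin : ∀ l : G →* ℂˣ, ∃ k, l ^ p ^ k = 1)
    (hX : ∀ (M : Subgroup G) [M.Normal], M ≠ ⊥ → XP p (G ⧸ M))
    (hQ : ¬ IsPGroup p (G ⧸ N)) : False := by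
  have hp : p.Prime := Fact.out
  obtain ⟨M, ⟨hM1, hM2, hM3⟩, hM4⟩ : ∃ M, Maximal (fun M : Subgroup G => M.Normal ∧ N ≤ M ∧
      ¬ ∀ g : G, ∃ k, g ^ p ^ k ∈ M) M := by
    refine exists_maximal_of_wellFoundedGT _ ⟨N, hNn, le_rfl, fun h => hQ fun g => ?_⟩
    obtain ⟨g, rfl⟩ := QuotientGroup.mk'_surjective N g
    obtain ⟨k, hk⟩ := h g
    exact ⟨k, by rw [← map_pow]; exact (QuotientGroup.eq_one_iff _).2 hk⟩
  have hMb : M ≠ ⊥ := fun h => hN.2.1 (le_bot_iff.1 (h ▸ hM2))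
  have hsurj := QuotientGroup.mk'_surjective M
  obtain ⟨V, hVn, r, m, i, hV, hab, hr, hrp, hrV, hcomm, hcV, hi, hb⟩ :=
    gamma_struct (Γ := G ⧸ M) (p := p) (b := b) (hX M hMb) (by
      intro h
      apply hM3
      intro g
      obtain ⟨k, hk⟩ := h (QuotientGroup.mk' M g)
      rw [← map_pow] at hk
      exact ⟨k, (QuotientGroup.eq_one_iff _).1 hk⟩) (by
      intro L hL hLb g
      obtain ⟨g, rfl⟩ := hsurj g
      by_contra hcon
      push Not at hcon
      have hle : M ≤ L.comap (QuotientGroup.mk' M) := by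
        intro x hx
        rw [Subgroup.mem_comap]
        have : QuotientGroup.mk' M x = 1 := (QuotientGroup.eq_one_iff _).2 hx
        rw [this]; exact L.one_mem
      have := hM4 (y := L.comap (QuotientGroup.mk' M)) ⟨hL.comap _, hM2.trans hle, fun h => by
        obtain ⟨k, hk⟩ := h g
        rw [Subgroup.mem_comap, map_pow] at hk
        exact hcon k hk⟩ hle
      apply hLb
      rw [eq_bot_iff]
      intro x hx
      obtain ⟨x, rfl⟩ := hsurj x
      have : x ∈ M := this hx
      exact (QuotientGroup.eq_one_iff _).2 this) (by
      intro l
      obtain ⟨k, hk⟩ := hlin (l.comp (QuotientGroup.mk' M))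
      refine ⟨k, ?_⟩
      refine MonoidHom.ext fun q => ?_
      obtain ⟨g, rfl⟩ := hsurj q
      have := DFunLike.congr_fun hk g
      simpa using this) ((codSet_surj _ hsurj).trans hc)
  obtain ⟨f, k, hbf, hf0, -, hk, -⟩ := lemmaFsum hN hp hd hc
  rw [hb] at hbf
  have e1 : Nat.card V * f = Nat.card G := by exact_mod_cast hbf
  have e2 : Nat.card G = Nat.card V * p ^ i * Nat.card M := by
    have h1 := M.card_mul_index
    have h2 := V.card_mul_index
    rw [hi] at h2
    rw [← h1, Subgroup.index, ← h2]; ring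
  have hV0 := Nat.card_pos (α := V)
  have hN0 := Nat.card_pos (α := N)
  have e3 : f = p ^ i * Nat.card M := by
    rw [e2, mul_assoc] at e1
    exact Nat.eq_of_mul_eq_mul_left hV0 e1
  obtain ⟨c, hcM⟩ := Subgroup.card_dvd_of_le hM2
  have e4 : k * f * Nat.card N = Nat.card V * (Nat.card N - 1) := by
    have h1 : f * (k * f * Nat.card N) = f * (Nat.card V * (Nat.card N - 1)) := by
      calc f * (k * f * Nat.card N) = Nat.card N * (k * f ^ 2) := by ring
        _ = (Nat.card N * N.index) * (Nat.card N - 1) := by rw [hk]; ring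
        _ = (Nat.card V * f) * (Nat.card N - 1) := by rw [N.card_mul_index, e1]
        _ = _ := by ring
    exact Nat.eq_of_mul_eq_mul_left hf0 h1
  have hN1 : 1 < Nat.card N := by
    have : Nat.card N ≠ 1 := fun h => hN.2.1 (Subgroup.card_eq_one.1 h)
    omega
  have hcop : Nat.Coprime (Nat.card N) (Nat.card N - 1) := by
    rw [Nat.coprime_self_sub_right hN1.le]; exact Nat.coprime_one_right _
  have e5 : Nat.card N ^ 2 ∣ Nat.card V := by
    have : Nat.card N ^ 2 ∣ Nat.card V * (Nat.card N - 1) :=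
      ⟨k * p ^ i * c, by rw [← e4, e3, hcM]; ring⟩
    exact (hcop.pow_left 2).dvd_of_dvd_mul_right this
  have e6 : p ^ i ∣ Nat.card N - 1 := by
    have : p ^ i ∣ Nat.card V * (Nat.card N - 1) :=
      ⟨k * Nat.card M * Nat.card N, by rw [← e4, e3]; ring⟩
    rw [hcV] at this
    exact (Nat.Coprime.pow _ _ ((Nat.coprime_primes hp hr).2 hrp.symm)).dvd_of_dvd_mul_left this
  obtain ⟨n, -, hn⟩ := (Nat.dvd_prime_pow hr).1 (hcV ▸ (dvd_pow_self _ two_ne_zero).trans e5 :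
    Nat.card N ∣ r ^ m)
  have hn0 : n ≠ 0 := by
    rintro rfl
    rw [pow_zero] at hn
    omega
  have hbound := group_bound hV hab hr (n := n) hrV hcomm (fun x => by
    have h1 : x⁻¹ * x ^ r ^ n = x ^ (Nat.card N - 1) := by
      rw [← hn, inv_mul_eq_iff_eq_mul, ← pow_succ']
      congr 1; omega
    rw [h1]
    obtain ⟨d, hd⟩ := e6
    rw [hd, pow_mul, ← hi]
    exact pow_mem (Subgroup.pow_index_mem V x) _) hn0
  rw [← hn] at hbound
  have := Nat.le_of_dvd hV0 e5
  nlinarith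

end CaseII


section Final

lemma exists_orderOf_prime {H : Type} [Monoid H] {q : ℕ} {x : H} (h0 : orderOf x ≠ 0)
    (hd : q ∣ orderOf x) : ∃ y : H, orderOf y = q :=
  ⟨x ^ (orderOf x / q), orderOf_pow_orderOf_div h0 hd⟩

lemma prime_dvd_orderOf {H : Type} [Monoid H] {p k : ℕ} (hp : p.Prime) {x : H} (hx : x ≠ 1)
    (h : x ^ p ^ k = 1) : p ∣ orderOf x := by
  obtain ⟨j, -, hj⟩ := (Nat.dvd_prime_pow hp).1 (orderOf_dvd_of_pow_eq_one h)
  rw [hj]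
  refine dvd_pow_self _ ?_
  rintro rfl
  rw [pow_zero, orderOf_eq_one_iff] at hj
  exact hx hj

lemma lin_mem_codSet {G : Type} [Group G] [Finite G] (l : G →* ℂˣ) :
    ((orderOf l : ℕ) : ℂ) ∈ codSet G :=
  ⟨_, irr_lin l, codeg_lin l⟩

lemma lin_orderOf_ne {G : Type} [Group G] [Finite G] (l : G →* ℂˣ) : orderOf l ≠ 0 :=
  (orderOf_pos l).ne'

lemma prime_mem_codSet {G : Type} [Group G] [Finite G] {l : G →* ℂˣ} {q : ℕ}
    (h : q ∣ orderOf l) : (q : ℂ) ∈ codSet G := by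
  obtain ⟨m, hm⟩ := exists_orderOf_prime (lin_orderOf_ne l) h
  rw [← hm]
  exact lin_mem_codSet m

theorem XP_of_Hyp (p : ℕ) [hpf : Fact p.Prime] : ∀ n : ℕ, ∀ (G : Type) [Group G] [Finite G],
    Nat.card G = n → Hyp p G → XP p G := by
  have hp : p.Prime := Fact.out
  intro n
  induction n using Nat.strong_induction_on with
  | _ n ih =>
  intro G _ _ hn hH
  by_contra hcon
  have hnt : Nontrivial G := by
    by_contra h
    rw [not_nontrivial_iff_subsingleton] at h
    exact hcon ⟨⊥, inferInstance, by simp +contextual,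
      fun g => ⟨0, by rw [Subsingleton.elim (g ^ p ^ 0) 1]; exact Subgroup.one_mem _⟩⟩
  have hX : ∀ (M : Subgroup G) [M.Normal], M ≠ ⊥ → XP p (G ⧸ M) := by
    intro M _ hM
    refine ih (Nat.card (G ⧸ M)) ?_ (G ⧸ M) rfl
      (hH.surj (QuotientGroup.mk' M) (QuotientGroup.mk'_surjective M))
    have h1 := M.card_mul_index
    have h2 : 1 < Nat.card M := (Subgroup.one_lt_card_iff_ne_bot M).2 hM
    have h3 : 0 < Nat.card (G ⧸ M) := Nat.card_pos
    rw [← hn, ← h1, Subgroup.index]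
    nlinarith
  obtain ⟨N, hN⟩ := exists_UMN hX hcon
  have hNn : N.Normal := hN.1
  obtain ⟨hlin, x, y, hc⟩ := hH
  by_cases hT : N = ⊤
  · subst hT
    exact hcon ⟨⊤, inferInstance, fun a _ b _ => simple_case hN hc a b, fun g => ⟨0, trivial⟩⟩
  have hQn : Nontrivial (G ⧸ N) := by
    by_contra h
    rw [not_nontrivial_iff_subsingleton] at h
    exact hT (QuotientGroup.subgroup_eq_top_of_subsingleton N h)
  obtain ⟨l, hl⟩ := (hX N hN.2.1).lin
  have hHQ : Hyp p (G ⧸ N) := Hyp.surj ⟨hlin, x, y, hc⟩ (QuotientGroup.mk' N)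
    (QuotientGroup.mk'_surjective N)
  obtain ⟨k, hk⟩ := hHQ.1 l
  have hpm : (p : ℂ) ∈ codSet G :=
    codSet_surj (QuotientGroup.mk' N) (QuotientGroup.mk'_surjective N)
      (prime_mem_codSet (prime_dvd_orderOf hp hl hk))
  have hd : p ∣ N.index := by
    obtain ⟨g, hg⟩ : ∃ g, l g ≠ 1 := by
      by_contra h
      push Not at h
      exact hl (MonoidHom.ext h)
    have h1 : (l g) ^ p ^ k = 1 := by
      have := DFunLike.congr_fun hk g
      simpa using this
    exact (prime_dvd_orderOf hp hg h1).trans ((orderOf_map_dvd l g).trans (orderOf_dvd_natCard g))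
  have hp1 : (p : ℂ) ≠ 1 := by exact_mod_cast hp.one_lt.ne'
  obtain ⟨b, hcb⟩ : ∃ b : ℂ, codSet G ⊆ {1, (p : ℂ), b} := by
    rcases hc hpm with h | h | h
    · exact absurd h hp1
    · exact ⟨y, by rw [h]; exact hc⟩
    · refine ⟨x, fun z hz => ?_⟩
      have h' : (p : ℂ) = y := h
      rw [h']
      rcases hc hz with h | h | h
      · exact Or.inl h
      · exact Or.inr (Or.inr h)
      · exact Or.inr (Or.inl h)
  by_cases hQ : IsPGroup p (G ⧸ N)
  · exact hcon (case_i hN hd hcb hlin hQ)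
  · exact case_ii hN hd hcb hlin hX hQ

lemma exists_cover {S : Set ℂ} (hf : S.Finite) (h1 : (1 : ℂ) ∈ S) (h : S.ncard ≤ 3) :
    ∃ x y : ℂ, S ⊆ {1, x, y} := by
  have h2 : (S \ {1}).ncard ≤ 2 := by
    have := Set.ncard_diff_singleton_add_one h1 hf
    omega
  have key : ∃ x y : ℂ, S \ {1} ⊆ {x, y} := by
    have hf2 : (S \ {1}).Finite := hf.subset Set.diff_subset
    rcases Nat.lt_or_ge (S \ {1}).ncard 2 with h3 | h3
    · obtain ⟨a, ha⟩ := (Set.ncard_le_one_iff_subset_singleton (s := S \ {1}) (hs := hf2)).1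
        (by omega)
      exact ⟨a, a, by simpa using ha⟩
    · obtain ⟨a, b, -, hab⟩ := Set.ncard_eq_two.1 (le_antisymm h2 h3)
      exact ⟨a, b, hab.subset⟩
  obtain ⟨x, y, hxy⟩ := key
  refine ⟨x, y, fun z hz => ?_⟩
  by_cases hz1 : z = 1
  · exact Or.inl hz1
  · exact Or.inr (hxy ⟨hz, hz1⟩)

lemma codSet_finite (G : Type) [Group G] [Finite G] : (codSet G).Finite := by
  refine ((irr_finite G).image codeg).subset ?_
  rintro c ⟨χ, hχ, rfl⟩
  exact ⟨χ, hχ, rfl⟩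

lemma no_four {x y a b c : ℂ} (ha : a ∈ ({1, x, y} : Set ℂ)) (hb : b ∈ ({1, x, y} : Set ℂ))
    (hc : c ∈ ({1, x, y} : Set ℂ)) (h1 : a ≠ 1) (h2 : b ≠ 1) (h3 : c ≠ 1) (h4 : a ≠ b)
    (h5 : a ≠ c) (h6 : b ≠ c) : False := by
  simp only [Set.mem_insert_iff, Set.mem_singleton_iff] at ha hb hc
  grind

lemma exists_Hyp (G : Type) [Group G] [Finite G] (h : (codSet G).ncard ≤ 3) :
    ∃ p : ℕ, p.Prime ∧ Hyp p G := by
  have h1 : (1 : ℂ) ∈ codSet G := by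
    have := lin_mem_codSet (1 : G →* ℂˣ)
    rwa [orderOf_one, Nat.cast_one] at this
  obtain ⟨x, y, hc⟩ := exists_cover (codSet_finite G) h1 h
  by_cases hall : ∀ l : G →* ℂˣ, l = 1
  · exact ⟨2, Nat.prime_two, fun l => ⟨0, by rw [hall l]; exact MonoidHom.ext fun g => by simp⟩, x, y, hc⟩
  push Not at hall
  obtain ⟨l, hl⟩ := hall
  obtain ⟨p, hp, hpl⟩ := Nat.exists_prime_and_dvd (n := orderOf l)
    (fun h => hl (orderOf_eq_one_iff.1 h))
  refine ⟨p, hp, fun m => ?_, x, y, hc⟩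
  have key : ∀ q : ℕ, q.Prime → q ∣ orderOf m → q = p := by
    intro q hq hqm
    by_contra hne
    obtain ⟨l', hl'⟩ := exists_orderOf_prime (lin_orderOf_ne l) hpl
    obtain ⟨m', hm'⟩ := exists_orderOf_prime (lin_orderOf_ne m) hqm
    have hcop : Nat.Coprime p q := (Nat.coprime_primes hp hq).2 (Ne.symm hne)
    have e := (Commute.all l' m').orderOf_mul_eq_mul_orderOf_of_coprime (by rw [hl', hm']; exact hcop)
    rw [hl', hm'] at e
    have a1 := hc (lin_mem_codSet l')
    have a2 := hc (lin_mem_codSet m')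
    have a3 := hc (lin_mem_codSet (l' * m'))
    rw [hl'] at a1
    rw [hm'] at a2
    rw [e] at a3
    have p1 := hp.one_lt
    have q1 := hq.one_lt
    refine no_four a1 a2 a3 ?_ ?_ ?_ ?_ ?_ ?_
    · exact_mod_cast p1.ne'
    · exact_mod_cast q1.ne'
    · have : p * q ≠ 1 := by nlinarith
      exact_mod_cast this
    · exact_mod_cast (Ne.symm hne)
    · have : p ≠ p * q := by nlinarith
      exact_mod_cast this
    · have : q ≠ p * q := by nlinarith
      exact_mod_cast this
  have e := Nat.eq_prime_pow_of_unique_prime_dvd (lin_orderOf_ne m) (fun {d} => key d)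
  refine ⟨(orderOf m).primeFactorsList.length, ?_⟩
  rw [← e]
  exact pow_orderOf_eq_one m

end Final

/-- **Theorem 1.** If a finite group `G` has at most three codegrees, then `G` is an M-group. -/
theorem mGroup_of_card_codSet_le_three (G : Type) [Group G] [Finite G]
    (h : (codSet G).ncard ≤ 3) : IsMGroup G := by
  obtain ⟨p, hp, hH⟩ := exists_Hyp G h
  haveI : Fact p.Prime := ⟨hp⟩
  exact mGroup_of_XP p (XP_of_Hyp p _ G rfl hH)
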